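/- Fix an integer d ≥ 3 and reals h,γ > 0. There exist a constant c' > 0 and an integer N (both depending only on d, h, γ) such that for every n ≥ N and every pair of graphs G, H on n vertices satisfying the hypotheses, there exists a family M of bijections (equivalently, with nonzero probability over the independent uniform random choice of the bijections M_e) such that every integral solution f of the 0-Extension instance 𝓘(X(G,H,M)) has cost at least c'·n²·(log n)^{2/3}. -/

import Mathlib

open Finset

noncomputable section

/-- A semi-metric on a type `V`. -/
def IsSemiMetric {V : Type} (δ : V → V → ℝ) : Prop :=
  (∀ u v, 0 ≤ δ u v) ∧ (∀ u, δ u u = 0) ∧ (∀ u v, δ u v = δ v u) ∧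
    ∀ u v w, δ u w ≤ δ u v + δ v w

/-- The length of a walk with respect to edge lengths `ℓ`. -/
def walkCost {V : Type} {Gr : SimpleGraph V} (ℓ : Sym2 V → ℝ) {u v : V} (p : Gr.Walk u v) : ℝ :=
  (p.edges.map ℓ).sum

/-- The shortest-path (semi-)metric of the graph `Gr` with edge lengths `ℓ`. -/
def spDist {V : Type} (Gr : SimpleGraph V) (ℓ : Sym2 V → ℝ) (u v : V) : ℝ :=
  sInf {r : ℝ | ∃ p : Gr.Walk u v, r = walkCost ℓ p}

/-- `EO` is an orientation of the edges of `G`: it consists of ordered pairs of adjacent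
vertices and contains exactly one of the two orientations of every edge of `G`. -/
def IsOrientation {V : Type} (G : SimpleGraph V) (EO : Finset (V × V)) : Prop :=
  (∀ p ∈ EO, G.Adj p.1 p.2) ∧ ∀ a b : V, G.Adj a b → ((a, b) ∈ EO ↔ (b, a) ∉ EO)

variable {VG VH : Type}

/-- The defining relation of the extension graph `X(G,H,M)`: intra-cloud edges coming from
`H`, and inter-cloud matching edges determined by the bijections `M_e`, `e ∈ EG`. -/
def ExtRel (H : SimpleGraph VH) (EG : Finset (VG × VG)) (M : VG × VG → VH ≃ VH) :
    VG × VH → VG × VH → Prop := fun x y =>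
  (x.1 = y.1 ∧ H.Adj x.2 y.2) ∨ ((x.1, y.1) ∈ EG ∧ y.2 = M (x.1, y.1) x.2)

/-- The extension graph `X(G,H,M)` on the vertex set `V_G × V_H`. -/
def ExtGraph (H : SimpleGraph VH) (EG : Finset (VG × VG)) (M : VG × VG → VH ≃ VH) :
    SimpleGraph (VG × VH) := SimpleGraph.fromRel (ExtRel H EG M)

/-- Edge lengths on `X(G,H,M)`: intra-cloud edges have length `(log n)^{1/3}` and
inter-cloud edges have length `(log n)^{2/3}`. -/
def extLen (n : ℕ) [DecidableEq VG] : Sym2 (VG × VH) → ℝ := fun e =>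
  if (Sym2.map Prod.fst e).IsDiag then Real.log n ^ ((1 : ℝ) / 3)
  else Real.log n ^ ((2 : ℝ) / 3)

/-- `D_X`, the shortest-path metric of the extension graph `X(G,H,M)`. -/
def extDist (n : ℕ) [DecidableEq VG] (H : SimpleGraph VH) (EG : Finset (VG × VG))
    (M : VG × VG → VH ≃ VH) : VG × VH → VG × VH → ℝ :=
  spDist (ExtGraph H EG M) (extLen n)

/-- The vertex set of the `0-Extension` instance `𝓘(X)`: the vertices of `X` (`Sum.inl`)
together with a disjoint copy serving as terminals (`Sum.inr`). -/
abbrev IV (VG VH : Type) : Type := (VG × VH) ⊕ (VG × VH)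

/-- The edges of the instance graph `𝒢` of `𝓘(X)`, as oriented pairs: intra-cloud edges
(from an orientation `EH` of `H`), inter-cloud matching edges (from an orientation `EG` of
`G` and the bijections `M`), and the pendant edges `(v, v_T)`. -/
def instEdges [Fintype VG] [Fintype VH] [DecidableEq VG] [DecidableEq VH]
    (EH : Finset (VH × VH)) (EG : Finset (VG × VG)) (M : VG × VG → VH ≃ VH) :
    Finset (IV VG VH × IV VG VH) :=
  ((Finset.univ ×ˢ EH).image fun p => (Sum.inl (p.1, p.2.1), Sum.inl (p.1, p.2.2))) ∪
    ((EG ×ˢ (Finset.univ : Finset VH)).image fun p =>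
      (Sum.inl (p.1.1, p.2), Sum.inl (p.1.2, M p.1 p.2))) ∪
    ((Finset.univ : Finset (VG × VH)).image fun x => (Sum.inl x, Sum.inr x))

/-- The edge weights of `𝓘(X)`: every edge of `X` has weight the reciprocal of its
length, and pendant edges have weight `1/L` with `L = log n`. -/
def instW (n : ℕ) [DecidableEq VG] : IV VG VH × IV VG VH → ℝ := fun p =>
  match p with
  | (Sum.inl x, Sum.inl y) =>
      if x.1 = y.1 then (Real.log n ^ ((1 : ℝ) / 3))⁻¹ else (Real.log n ^ ((2 : ℝ) / 3))⁻¹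
  | (Sum.inl _, Sum.inr _) => (Real.log n)⁻¹
  | _ => 0

/-- The metric on the terminals of `𝓘(X)`: `D(u_T, v_T) = D_X(u,v) + 2L` for `u ≠ v`,
with `L = log n` (extended by `0` on non-terminal arguments). -/
def instD (n : ℕ) [DecidableEq VG] [DecidableEq VH] (H : SimpleGraph VH)
    (EG : Finset (VG × VG)) (M : VG × VG → VH ≃ VH) : IV VG VH → IV VG VH → ℝ := fun a b =>
  match a, b with
  | Sum.inr u, Sum.inr v =>
      if u = v then 0 else extDist n H EG M u v + 2 * Real.log n
  | _, _ => 0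

/-- An integral solution of `𝓘(X)`: a map into the terminals fixing every terminal. -/
def IsIntegralSolution {VG VH : Type} (f : IV VG VH → IV VG VH) : Prop :=
  (∀ v : IV VG VH, ∃ x : VG × VH, f v = Sum.inr x) ∧
    ∀ x : VG × VH, f (Sum.inr x) = Sum.inr x

/-- The cost of an integral solution `f` of `𝓘(X)`. -/
def intCost (n : ℕ) [Fintype VG] [Fintype VH] [DecidableEq VG] [DecidableEq VH]
    (H : SimpleGraph VH) (EH : Finset (VH × VH)) (EG : Finset (VG × VG))
    (M : VG × VG → VH ≃ VH) (f : IV VG VH → IV VG VH) : ℝ :=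
  ∑ p ∈ instEdges EH EG M, instW n p * instD n H EG M (f p.1) (f p.2)

/-- `G` is a Cayley graph of the group `Γ` with respect to `d` generators. -/
def IsCayley {Γ : Type} [Group Γ] (G : SimpleGraph Γ) (d : ℕ) : Prop :=
  ∃ S : Finset Γ, S.card = d ∧ (1 : Γ) ∉ S ∧ (∀ s ∈ S, s⁻¹ ∈ S) ∧
    ∀ a b : Γ, G.Adj a b ↔ a⁻¹ * b ∈ S

/-- Every cycle of `G` has length at least `g`. -/
def GirthAtLeast {V : Type} (G : SimpleGraph V) (g : ℝ) : Prop :=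
  ∀ (v : V) (c : G.Walk v v), c.IsCycle → g ≤ (c.length : ℝ)

/-- `G` has edge expansion at least `h`: every `S` with `|S| ≤ |V|/2` has at least `h·|S|`
edges leaving it (counted as ordered pairs `(u,v)`, `u ∈ S`, `v ∉ S`, `u ~ v`, which
counts each leaving edge exactly once). -/
def EdgeExpansionAtLeast {V : Type} [Fintype V] (G : SimpleGraph V) (h : ℝ) : Prop :=
  ∀ S : Finset V, 2 * S.card ≤ Fintype.card V →
    h * (S.card : ℝ) ≤ ({p : V × V | G.Adj p.1 p.2 ∧ p.1 ∈ S ∧ p.2 ∉ S}.ncard : ℝ)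

/-- The hypotheses on the pair `(G, H)`: both are connected `d`-regular Cayley graphs on
`n` vertices with edge expansion at least `h` and girth at least `γ·log n`. -/
def GoodPair (d : ℕ) (h γ : ℝ) (n : ℕ) {VG VH : Type} [Fintype VG] [Fintype VH]
    [Group VG] [Group VH] (G : SimpleGraph VG) (H : SimpleGraph VH) : Prop :=
  Fintype.card VG = n ∧ Fintype.card VH = n ∧ G.Connected ∧ H.Connected ∧
    (∀ v, (G.neighborSet v).ncard = d) ∧ (∀ v, (H.neighborSet v).ncard = d) ∧
    IsCayley G d ∧ IsCayley H d ∧ EdgeExpansionAtLeast G h ∧ EdgeExpansionAtLeast H h ∧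
    GirthAtLeast G (γ * Real.log n) ∧ GirthAtLeast H (γ * Real.log n)

section Split

variable {VG VH : Type}

/-- The multiset of edges of `G` obtained by projecting a walk of the extension graph to
the graph `G` via `π = Prod.fst` (intra-cloud steps project to loops and are dropped). -/
def projEdges [DecidableEq VG] {X : SimpleGraph (VG × VH)} {a b : VG × VH}
    (p : X.Walk a b) : Multiset (Sym2 VG) :=
  Multiset.filter (fun e => ¬ e.IsDiag)
    (Multiset.map (Sym2.map Prod.fst) (p.edges : Multiset (Sym2 (VG × VH))))

/-- Given, for every edge of a subgraph `G'` of `G`, a multiset of edges of `G`, the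
combined multiset collected along a walk of `G` all of whose edges lie in `G'`. -/
def combinedEdges {V : Type} {G : SimpleGraph V} {G' : G.Subgraph}
    (Q : ∀ {a b : V}, G'.Adj a b → Multiset (Sym2 V)) :
    {u v : V} → (c : G.Walk u v) → (∀ e ∈ c.edges, e ∈ G'.edgeSet) → Multiset (Sym2 V)
  | _, _, SimpleGraph.Walk.nil, _ => 0
  | _, _, @SimpleGraph.Walk.cons _ _ u v w _ p, hmem =>
      Q (SimpleGraph.Subgraph.mem_edgeSet.mp (hmem s(u, v) (by simp))) +
        combinedEdges Q p (fun e he => hmem e (by simp [he]))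

/-- `(f̃, P)` (encoded by the multisets `Q` of edges of the walks `P(e)`) is a
cycle-homeomorphism of `G` with respect to `G'`: for every simple cycle `C` of `G` all of
whose edges lie in `G'`, the set of edges of `G` appearing an odd number of times in the
combined multiset of the walks assigned to the edges of `C` is exactly the edge set of
`C`. -/
def IsCycleHomeo {V : Type} [DecidableEq V] {G : SimpleGraph V} (G' : G.Subgraph)
    (Q : ∀ {a b : V}, G'.Adj a b → Multiset (Sym2 V)) : Prop :=
  ∀ (v : V) (c : G.Walk v v), c.IsCycle →
    ∀ hmem : ∀ e ∈ c.edges, e ∈ G'.edgeSet,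
      {e : Sym2 V | Odd ((combinedEdges Q c hmem).count e)} = {e : Sym2 V | e ∈ c.edges}

end Split

/-- `f̄ : V_{G'} → V_G × V_H` is an `(α, ε)`-split of the extension graph `X(G,H,M)`:
`G'` is a subgraph of `G` with at least `(1−ε)|E_G|` edges; there is a choice `P` of
shortest paths in `X` between the images under `f̄` of the endpoints of each edge of `G'`
whose projections to `G` make `(π ∘ f̄, P_{π∘f̄})` a cycle-homeomorphism of `G` with
respect to `G'`; `D_X(f̄(g₁), f̄(g₂)) < α` for every edge `(g₁,g₂)` of `G'`; and for every
`g ∈ V_{G'}` the shortest path in `G` between `g` and `π(f̄(g))` has at most `ε·log n`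
edges. -/
def IsSplit (n : ℕ) {VG VH : Type} [Fintype VG] [DecidableEq VG] [DecidableEq VH]
    (G : SimpleGraph VG) (H : SimpleGraph VH) (EG : Finset (VG × VG))
    (M : VG × VG → VH ≃ VH) (α ε : ℝ) (G' : G.Subgraph) (fbar : VG → VG × VH) : Prop :=
  (1 - ε) * (G.edgeSet.ncard : ℝ) ≤ (G'.edgeSet.ncard : ℝ) ∧
  (∃ P : ∀ {g₁ g₂ : VG}, G'.Adj g₁ g₂ → (ExtGraph H EG M).Walk (fbar g₁) (fbar g₂),
    (∀ {g₁ g₂ : VG} (hadj : G'.Adj g₁ g₂),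
      walkCost (extLen n) (P hadj) = extDist n H EG M (fbar g₁) (fbar g₂)) ∧
    IsCycleHomeo G' (fun {_ _} hadj => projEdges (P hadj))) ∧
  (∀ {g₁ g₂ : VG}, G'.Adj g₁ g₂ → extDist n H EG M (fbar g₁) (fbar g₂) < α) ∧
  ∀ g ∈ G'.verts, (G.dist g (fbar g).1 : ℝ) ≤ ε * Real.log n

/-- The cloud of a vertex of the instance graph (for a terminal `v_T`, the cloud of `v`). -/
def cloudOf {VG VH : Type} : IV VG VH → VG := fun v =>
  match v with
  | Sum.inl x => x.1
  | Sum.inr x => x.1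

/-- Edge lengths on the instance graph `𝒢` of `𝓘(X)`: every edge coming from `X` keeps
its length in `X` (`(log n)^{1/3}` intra-cloud, `(log n)^{2/3}` inter-cloud) and every
pendant edge `(v, v_T)` has length `L = log n`. -/
def instLen (n : ℕ) {VG VH : Type} [DecidableEq VG] : Sym2 (IV VG VH) → ℝ := fun e =>
  if (Sym2.map Sum.isLeft e).IsDiag then
    (if (Sym2.map cloudOf e).IsDiag then Real.log n ^ ((1 : ℝ) / 3)
      else Real.log n ^ ((2 : ℝ) / 3))
  else Real.log n

/-- The instance graph `𝒢` of `𝓘(X)`, whose edges are the elements of `instEdges`. -/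
def instGraph {VG VH : Type} [Fintype VG] [Fintype VH] [DecidableEq VG] [DecidableEq VH]
    (EH : Finset (VH × VH)) (EG : Finset (VG × VG)) (M : VG × VG → VH ≃ VH) :
    SimpleGraph (IV VG VH) :=
  SimpleGraph.fromRel fun a b => (a, b) ∈ instEdges EH EG M

/-! ### Counting families of bijections -/

theorem pow_le_three_pow_mul_descFactorial {n q : ℕ} (hq : q ≤ n) :
    (n : ℝ) ^ q ≤ 3 ^ q * (n.descFactorial q : ℝ) := by
  induction n generalizing q with
  | zero => obtain rfl : q = 0 := by omega
            simp
  | succ n ih =>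
    cases q with
    | zero => simp
    | succ q =>
      have hq' : q ≤ n := by omega
      have h1 := ih hq'
      rw [Nat.succ_descFactorial_succ]
      have h2 : ((n : ℝ) + 1) ^ q ≤ 3 * (n : ℝ) ^ q := by
        rcases Nat.eq_zero_or_pos n with rfl | hn
        · obtain rfl : q = 0 := by omega
          norm_num
        · have hn' : (0 : ℝ) < n := by exact_mod_cast hn
          have h3 : (n : ℝ) + 1 ≤ n * Real.exp (1 / n) := by
            have := Real.add_one_le_exp (1 / (n : ℝ))
            calc (n : ℝ) + 1 = n * (1 / n + 1) := by field_simp; ring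
              _ ≤ _ := by gcongr
          calc ((n : ℝ) + 1) ^ q ≤ (n * Real.exp (1 / n)) ^ q := by gcongr
            _ = n ^ q * Real.exp (q * (1 / n)) := by rw [mul_pow, Real.exp_nat_mul]
            _ ≤ n ^ q * Real.exp 1 := by
              gcongr
              rw [mul_one_div, div_le_one hn']
              exact_mod_cast hq'
            _ ≤ n ^ q * 3 := by
              gcongr
              linarith [Real.exp_one_lt_d9]
            _ = _ := by ring
      push_cast
      calc ((n : ℝ) + 1) ^ (q + 1) = (n + 1) * (n + 1) ^ q := by ring
        _ ≤ (n + 1) * (3 * (3 ^ q * (n.descFactorial q : ℝ))) := by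
          gcongr
          exact h2.trans (by gcongr)
        _ = _ := by ring

theorem card_equiv_extending_le {α : Type} [Fintype α] [DecidableEq α] (s : Finset (α × α)) :
    (#{σ : α ≃ α | ∀ p ∈ s, σ p.1 = p.2} : ℝ) ≤
      (3 / Fintype.card α) ^ #s * Fintype.card (α ≃ α) := by
  set n := Fintype.card α with hn
  by_cases hex : ∃ σ₀ : α ≃ α, ∀ p ∈ s, σ₀ p.1 = p.2
  swap
  · have : ({σ : α ≃ α | ∀ p ∈ s, σ p.1 = p.2} : Finset (α ≃ α)) = ∅ := by
      rw [Finset.filter_eq_empty_iff]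
      intro σ _ h
      exact hex ⟨σ, h⟩
    rw [this]
    simp only [card_empty, Nat.cast_zero]
    positivity
  obtain ⟨σ₀, hσ₀⟩ := hex
  set A := s.image Prod.fst with hA
  have hcard : #A = #s := by
    apply Finset.card_image_of_injOn
    intro p hp q hq hpq
    have h1 := hσ₀ p hp
    have h2 := hσ₀ q hq
    rw [show p.1 = q.1 from hpq] at h1
    exact Prod.ext hpq (h1.symm.trans h2)
  have hle : #A ≤ n := Finset.card_le_univ A
  have h1 : #{σ : α ≃ α | ∀ p ∈ s, σ p.1 = p.2} ≤ (n - #s).factorial := by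
    have e1 := Fintype.card_congr (Equiv.Perm.subtypeEquivSubtypePerm (fun a : α => a ∉ A))
    rw [Fintype.card_perm, Fintype.card_subtype_compl] at e1
    simp only [Fintype.card_coe] at e1
    rw [← hcard, e1, Fintype.card_subtype]
    apply Finset.card_le_card_of_injOn (fun σ => σ.trans σ₀.symm)
    · intro σ hσ
      simp only [coe_filter, mem_univ, true_and, Set.mem_ofPred_eq, not_not] at hσ ⊢
      intro a ha
      obtain ⟨p, hp, rfl⟩ := Finset.mem_image.mp ha
      rw [Equiv.trans_apply, hσ p hp, ← hσ₀ p hp, Equiv.symm_apply_apply]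
    · intro σ _ τ _ h
      ext a
      simpa using congrArg (fun g : α ≃ α => σ₀ (g a)) h
  have h2 : Fintype.card (α ≃ α) = (n - #s).factorial * n.descFactorial #s := by
    rw [Nat.factorial_mul_descFactorial (hcard ▸ hle), ← Fintype.card_perm]
  have h3 := pow_le_three_pow_mul_descFactorial (hcard ▸ hle)
  rw [h2]
  rcases Nat.eq_zero_or_pos n with h0 | hpos
  · have : #s = 0 := by omega
    rw [this] at h1 ⊢
    simpa using h1
  have hpos' : (0 : ℝ) < n := by exact_mod_cast hpos
  rw [div_pow, div_mul_eq_mul_div, le_div_iff₀ (by positivity)]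
  push_cast
  calc _ ≤ ((n - #s).factorial : ℝ) * (3 ^ #s * (n.descFactorial #s : ℝ)) := by
        gcongr
    _ = _ := by ring

/-- The family of bijections `M` satisfies all the matching constraints `(e, h₁, h₂)` of `s`,
i.e. `M e h₁ = h₂`. -/
def Extends (M : VG × VG → VH ≃ VH) (s : Finset ((VG × VG) × VH × VH)) : Prop :=
  ∀ c ∈ s, M c.1 c.2.1 = c.2.2

instance [DecidableEq VH] (M : VG × VG → VH ≃ VH) (s : Finset ((VG × VG) × VH × VH)) :
    Decidable (Extends M s) :=
  inferInstanceAs (Decidable (∀ c ∈ s, M c.1 c.2.1 = c.2.2))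

theorem card_extends_le [Fintype VG] [Fintype VH] [DecidableEq VG] [DecidableEq VH]
    (s : Finset ((VG × VG) × VH × VH)) :
    (#{M : VG × VG → VH ≃ VH | Extends M s} : ℝ) ≤
      (3 / Fintype.card VH) ^ #s * Fintype.card (VG × VG → VH ≃ VH) := by
  let t : VG × VG → Finset (VH × VH) := fun e => (s.filter (fun c => c.1 = e)).image Prod.snd
  have ht : ∀ e, #(t e) = #(s.filter (fun c => c.1 = e)) := by
    intro e
    apply Finset.card_image_of_injOn
    intro p hp q hq hpq
    simp only [coe_filter, Set.mem_ofPred_eq] at hp hq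
    exact Prod.ext (hp.2.trans hq.2.symm) hpq
  have h1 : ({M : VG × VG → VH ≃ VH | Extends M s} : Finset (VG × VG → VH ≃ VH)) =
      Fintype.piFinset (fun e => {σ : VH ≃ VH | ∀ p ∈ t e, σ p.1 = p.2}) := by
    ext M
    simp only [mem_filter, mem_univ, true_and, Fintype.mem_piFinset, t, mem_image]
    constructor
    · rintro h e p ⟨c, ⟨hc, rfl⟩, rfl⟩
      exact h c hc
    · intro h c hc
      exact h c.1 c.2 ⟨c, ⟨hc, rfl⟩, rfl⟩
  have h2 : #s = ∑ e, #(t e) := by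
    simp_rw [ht]
    exact Finset.card_eq_sum_card_fiberwise (fun x _ => by simp)
  rw [h1, Fintype.card_piFinset, Fintype.card_pi, h2, ← Finset.prod_pow_eq_pow_sum]
  push_cast
  rw [← Finset.prod_mul_distrib]
  exact Finset.prod_le_prod (fun _ _ => by positivity) (fun e _ => card_equiv_extending_le (t e))

/-! ### Exploring a connected set of vertices of the extension graph -/

/-- The first endpoint of a matching constraint. -/
def conFst (c : (VG × VG) × VH × VH) : VG × VH := (c.1.1, c.2.1)

/-- The second endpoint of a matching constraint. -/
def conSnd (c : (VG × VG) × VH × VH) : VG × VH := (c.1.2, c.2.2)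

/-- The matching constraint expressing that `x` and `y` are joined by an inter-cloud edge. -/
def matchCon [DecidableEq VG] (EG : Finset (VG × VG)) (x y : VG × VH) :
    (VG × VG) × VH × VH :=
  if (x.1, y.1) ∈ EG then ((x.1, y.1), x.2, y.2) else ((y.1, x.1), y.2, x.2)

theorem matchCon_ends [DecidableEq VG] (EG : Finset (VG × VG)) (x y : VG × VH) :
    (conFst (matchCon EG x y) = x ∧ conSnd (matchCon EG x y) = y) ∨
      (conFst (matchCon EG x y) = y ∧ conSnd (matchCon EG x y) = x) := by
  unfold matchCon
  split_ifs
  · exact Or.inl ⟨rfl, rfl⟩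
  · exact Or.inr ⟨rfl, rfl⟩

theorem matchCon_conFst_conSnd [DecidableEq VG] {EG : Finset (VG × VG)}
    {c : (VG × VG) × VH × VH} (hc : c.1 ∈ EG) : matchCon EG (conFst c) (conSnd c) = c := by
  unfold matchCon conFst conSnd
  simp [hc]

theorem matchCon_conSnd_conFst [DecidableEq VG] {G : SimpleGraph VG} {EG : Finset (VG × VG)}
    (hEG : IsOrientation G EG) {c : (VG × VG) × VH × VH} (hc : c.1 ∈ EG) :
    matchCon EG (conSnd c) (conFst c) = c := by
  unfold matchCon conFst conSnd
  have : (c.1.2, c.1.1) ∉ EG := (hEG.2 _ _ (hEG.1 _ hc)).mp hc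
  simp [this]

/-- The constraints with both endpoints in `U`. -/
def candidates [Fintype VG] [Fintype VH] [DecidableEq VG] [DecidableEq VH]
    (EG : Finset (VG × VG)) (U : Finset (VG × VH)) : Finset ((VG × VG) × VH × VH) :=
  {c | c.1 ∈ EG ∧ conFst c ∈ U ∧ conSnd c ∈ U}

/-- Adjacency inside `U` through intra-cloud edges or the inter-cloud edges in `F`. -/
def InnerRel (H : SimpleGraph VH) (U : Finset (VG × VH)) (F : Finset ((VG × VG) × VH × VH))
    (x y : VG × VH) : Prop :=
  x ∈ U ∧ y ∈ U ∧ ((x.1 = y.1 ∧ H.Adj x.2 y.2) ∨ ∃ c ∈ F, x = conFst c ∧ y = conSnd c)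

/-- The state of a depth-first exploration: visited vertices, the stack of vertices being
processed, and the matching constraints used to discover vertices. -/
structure ExploreState (VG VH : Type) where
  /-- The visited vertices. -/
  vis : Finset (VG × VH)
  /-- The stack. -/
  stack : List (VG × VH)
  /-- The constraints used so far. -/
  used : Finset ((VG × VG) × VH × VH)

/-- An instruction of an exploration: `none` pops the stack, the others push a neighbour of the
top of the stack. -/
abbrev Instr (SG : Finset VG) (SH : Finset VH) : Type := Option (SH ⊕ SG × VH)

/-- The weight of an instruction: instructions creating a matching constraint weigh `r`. -/
def instrWeight {SG : Finset VG} {SH : Finset VH} (r : ℝ) : Instr SG SH → ℝ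
  | some (Sum.inr _) => r
  | _ => 1

theorem sum_instrWeight [Fintype VH] (SG : Finset VG) (SH : Finset VH) (r : ℝ) :
    ∑ l : Instr SG SH, instrWeight r l = 1 + #SH + #SG * Fintype.card VH * r := by
  rw [Fintype.sum_option, Fintype.sum_sum_type]
  simp [instrWeight]
  ring

section Explore

variable [Group VG] [Group VH] [DecidableEq VG] [DecidableEq VH]

/-- One step of an exploration. -/
def exploreStep (EG : Finset (VG × VG)) {SG : Finset VG} {SH : Finset VH}
    (st : ExploreState VG VH) (l : Instr SG SH) : ExploreState VG VH :=
  match st.stack, l with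
  | [], _ => st
  | _ :: t, none => { st with stack := t }
  | x :: t, some (Sum.inl s) =>
      { st with vis := insert (x.1, x.2 * s) st.vis, stack := (x.1, x.2 * s) :: x :: t }
  | x :: t, some (Sum.inr (s, v)) =>
      { vis := insert (x.1 * s, v) st.vis
        stack := (x.1 * s, v) :: x :: t
        used := insert (matchCon EG x (x.1 * s, v)) st.used }

/-- The state of the exploration started at `x` after following the instructions `w`. -/
def explore (EG : Finset (VG × VG)) {SG : Finset VG} {SH : Finset VH} (x : VG × VH)
    (w : List (Instr SG SH)) : ExploreState VG VH :=
  w.foldl (exploreStep EG) ⟨{x}, [x], ∅⟩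

/-- The invariant of an exploration of `U` through intra-cloud edges and the constraints `F`. -/
structure ExploreInv (H : SimpleGraph VH) (U : Finset (VG × VH))
    (F : Finset ((VG × VG) × VH × VH)) (x₀ : VG × VH) (st : ExploreState VG VH) : Prop where
  root : x₀ ∈ st.vis
  stack_sub : ∀ x ∈ st.stack, x ∈ st.vis
  vis_sub : st.vis ⊆ U
  used_sub : st.used ⊆ F
  used_ends : ∀ c ∈ st.used, conFst c ∈ st.vis ∧ conSnd c ∈ st.vis
  saturated : ∀ x ∈ st.vis, x ∉ st.stack → ∀ y,
    InnerRel H U F x y ∨ InnerRel H U F y x → y ∈ st.vis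

theorem exists_instructions {G : SimpleGraph VG} {H : SimpleGraph VH} {EG : Finset (VG × VG)}
    (hEG : IsOrientation G EG) {SG : Finset VG} {SH : Finset VH}
    (hSG : ∀ a b, G.Adj a b ↔ a⁻¹ * b ∈ SG) (hSH : ∀ a b, H.Adj a b ↔ a⁻¹ * b ∈ SH)
    (r : ℝ) {U : Finset (VG × VH)} {F : Finset ((VG × VG) × VH × VH)}
    (hF : ∀ c ∈ F, c.1 ∈ EG) {x₀ : VG × VH} (N : ℕ) (st : ExploreState VG VH)
    (hN : 2 * (#U - #st.vis) + st.stack.length = N) (hinv : ExploreInv H U F x₀ st) :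
    ∃ w : List (Instr SG SH), w.length = N ∧
      ExploreInv H U F x₀ (w.foldl (exploreStep EG) st) ∧
      (w.foldl (exploreStep EG) st).stack = [] ∧
      r ^ #(w.foldl (exploreStep EG) st).used = r ^ #st.used * (w.map (instrWeight r)).prod := by
  induction N using Nat.strong_induction_on generalizing st with
  | _ N ih =>
  obtain ⟨vis, stack, used⟩ := st
  cases stack with
  | nil =>
    by_cases hU : #U - #vis = 0
    · refine ⟨[], ?_, hinv, rfl, by simp⟩
      simp at hN ⊢
      omega
    · -- pad with pops, which act trivially on the empty stack
      have key : ∀ k : ℕ, (List.replicate k (none : Instr SG SH)).foldl (exploreStep EG)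
          ⟨vis, [], used⟩ = ⟨vis, [], used⟩ := by
        intro k
        induction k with
        | zero => rfl
        | succ k ihk => rw [List.replicate_succ, List.foldl_cons]; exact ihk
      refine ⟨List.replicate N none, by simp, ?_, ?_, ?_⟩
      · rwa [key]
      · rw [key]
      · rw [key]
        simp [instrWeight]
  | cons x t =>
    have hxv : x ∈ vis := hinv.stack_sub x (by simp)
    by_cases hsat : ∀ y, InnerRel H U F x y ∨ InnerRel H U F y x → y ∈ vis
    · have hinv' : ExploreInv H U F x₀ ⟨vis, t, used⟩ :=
        { root := hinv.root
          stack_sub := fun z hz => hinv.stack_sub z (by simp at hz ⊢; exact Or.inr hz)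
          vis_sub := hinv.vis_sub
          used_sub := hinv.used_sub
          used_ends := hinv.used_ends
          saturated := by
            intro z hz hzt y hy
            by_cases hzx : z = x
            · subst hzx; exact hsat y hy
            · exact hinv.saturated z hz (by simp at hzt ⊢; exact ⟨hzx, hzt⟩) y hy }
      simp only [List.length_cons] at hN
      obtain ⟨w, hw1, hw2, hw3, hw4⟩ := ih (N - 1) (by omega) ⟨vis, t, used⟩
        (by simp only; omega) hinv'
      refine ⟨none :: w, by simp; omega, hw2, hw3, ?_⟩
      simp only [List.foldl_cons, List.map_cons, List.prod_cons, instrWeight, one_mul]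
      exact hw4
    · push Not at hsat
      obtain ⟨y, hxy, hyv⟩ := hsat
      have hyU : y ∈ U := hxy.elim (fun h => h.2.1) (fun h => h.1)
      have hlt : #vis < #U := Finset.card_lt_card
        ⟨hinv.vis_sub, fun h => hyv (h hyU)⟩
      have hins : #(insert y vis) = #vis + 1 := Finset.card_insert_of_notMem hyv
      simp only [List.length_cons] at hN
      have hsub : insert y vis ⊆ U := Finset.insert_subset hyU hinv.vis_sub
      have hsatu : ∀ used', (∀ z ∈ insert y vis, z ∉ (ExploreState.mk (insert y vis)
          (y :: x :: t) used').stack → ∀ y', InnerRel H U F z y' ∨ InnerRel H U F y' z →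
          y' ∈ insert y vis) := by
        intro used' z hz hzt y' hy'
        simp only [List.mem_cons, not_or] at hzt
        have hz' : z ∈ vis := Finset.mem_of_mem_insert_of_ne hz hzt.1
        exact Finset.mem_insert_of_mem (hinv.saturated z hz'
          (by simp only [List.mem_cons, not_or]; exact hzt.2) y' hy')
      have hstk : ∀ z ∈ y :: x :: t, z ∈ insert y vis := by
        intro z hz
        rcases List.mem_cons.mp hz with rfl | hz
        · simp
        · exact Finset.mem_insert_of_mem (hinv.stack_sub z hz)
      have hcases : (x.1 = y.1 ∧ H.Adj x.2 y.2) ∨ (G.Adj x.1 y.1 ∧ matchCon EG x y ∈ F) := by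
        rcases hxy with ⟨-, -, h | ⟨c, hc, rfl, rfl⟩⟩ | ⟨-, -, h | ⟨c, hc, rfl, rfl⟩⟩
        · exact Or.inl h
        · right
          rw [matchCon_conFst_conSnd (hF c hc)]
          exact ⟨hEG.1 _ (hF c hc), hc⟩
        · exact Or.inl ⟨h.1.symm, h.2.symm⟩
        · right
          rw [matchCon_conSnd_conFst hEG (hF c hc)]
          exact ⟨(hEG.1 _ (hF c hc)).symm, hc⟩
      rcases hcases with ⟨h1, h2⟩ | ⟨h1, h2⟩
      · have hy : y = (x.1, x.2 * (x.2⁻¹ * y.2)) := by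
          rw [mul_inv_cancel_left, h1]
        have hinv' : ExploreInv H U F x₀ ⟨insert y vis, y :: x :: t, used⟩ :=
          { root := Finset.mem_insert_of_mem hinv.root
            stack_sub := hstk
            vis_sub := hsub
            used_sub := hinv.used_sub
            used_ends := fun c hc => ⟨Finset.mem_insert_of_mem (hinv.used_ends c hc).1,
              Finset.mem_insert_of_mem (hinv.used_ends c hc).2⟩
            saturated := hsatu used }
        obtain ⟨w, hw1, hw2, hw3, hw4⟩ := ih (N - 1) (by omega) ⟨insert y vis, y :: x :: t, used⟩
          (by simp only [List.length_cons]; omega) hinv'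
        have hstep : exploreStep EG ⟨vis, x :: t, used⟩
            (some (Sum.inl ⟨x.2⁻¹ * y.2, (hSH _ _).mp h2⟩) : Instr SG SH) =
            ⟨insert y vis, y :: x :: t, used⟩ := by
          simp only [exploreStep]
          rw [← hy]
        refine ⟨some (Sum.inl ⟨x.2⁻¹ * y.2, (hSH _ _).mp h2⟩) :: w,
          by simp; omega, ?_, ?_, ?_⟩
        · rw [List.foldl_cons, hstep]; exact hw2
        · rw [List.foldl_cons, hstep]; exact hw3
        · rw [List.foldl_cons, hstep, hw4]
          simp [instrWeight]
      · have hy : y = (x.1 * (x.1⁻¹ * y.1), y.2) := by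
          rw [mul_inv_cancel_left]
        have hnew : matchCon EG x y ∉ used := by
          intro hmem
          have h3 := hinv.used_ends _ hmem
          rcases matchCon_ends EG x y with h4 | h4
          · exact hyv (h4.2 ▸ h3.2)
          · exact hyv (h4.1 ▸ h3.1)
        have hends : ∀ c ∈ insert (matchCon EG x y) used,
            conFst c ∈ insert y vis ∧ conSnd c ∈ insert y vis := by
          intro c hc
          rcases Finset.mem_insert.mp hc with rfl | hc
          · rcases matchCon_ends EG x y with h4 | h4
            · rw [h4.1, h4.2]
              exact ⟨Finset.mem_insert_of_mem hxv, Finset.mem_insert_self _ _⟩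
            · rw [h4.1, h4.2]
              exact ⟨Finset.mem_insert_self _ _, Finset.mem_insert_of_mem hxv⟩
          · exact ⟨Finset.mem_insert_of_mem (hinv.used_ends c hc).1,
              Finset.mem_insert_of_mem (hinv.used_ends c hc).2⟩
        have hinv' : ExploreInv H U F x₀
            ⟨insert y vis, y :: x :: t, insert (matchCon EG x y) used⟩ :=
          { root := Finset.mem_insert_of_mem hinv.root
            stack_sub := hstk
            vis_sub := hsub
            used_sub := Finset.insert_subset h2 hinv.used_sub
            used_ends := hends
            saturated := hsatu _ }
        obtain ⟨w, hw1, hw2, hw3, hw4⟩ := ih (N - 1) (by omega)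
          ⟨insert y vis, y :: x :: t, insert (matchCon EG x y) used⟩
          (by simp only [List.length_cons]; omega) hinv'
        have hstep : exploreStep EG ⟨vis, x :: t, used⟩
            (some (Sum.inr (⟨x.1⁻¹ * y.1, (hSG _ _).mp h1⟩, y.2)) : Instr SG SH) =
            ⟨insert y vis, y :: x :: t, insert (matchCon EG x y) used⟩ := by
          simp only [exploreStep]
          rw [← hy]
        refine ⟨some (Sum.inr (⟨x.1⁻¹ * y.1, (hSG _ _).mp h1⟩, y.2)) :: w,
          by simp; omega, ?_, ?_, ?_⟩
        · rw [List.foldl_cons, hstep]; exact hw2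
        · rw [List.foldl_cons, hstep]; exact hw3
        · rw [List.foldl_cons, hstep, hw4]
          simp only [Finset.card_insert_of_notMem hnew, pow_succ, List.map_cons, instrWeight,
            List.prod_cons, mul_assoc]

theorem explore_complete {G : SimpleGraph VG} {H : SimpleGraph VH} {EG : Finset (VG × VG)}
    (hEG : IsOrientation G EG) {SG : Finset VG} {SH : Finset VH}
    (hSG : ∀ a b, G.Adj a b ↔ a⁻¹ * b ∈ SG) (hSH : ∀ a b, H.Adj a b ↔ a⁻¹ * b ∈ SH)
    (r : ℝ) {U : Finset (VG × VH)} {F : Finset ((VG × VG) × VH × VH)}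
    (hF : ∀ c ∈ F, c.1 ∈ EG) {x₀ : VG × VH} (hx₀ : x₀ ∈ U)
    (hconn : ∀ y ∈ U, Relation.EqvGen (InnerRel H U F) x₀ y) {Λ : ℕ} (hΛ : 2 * #U ≤ Λ) :
    ∃ w : Fin Λ → Instr SG SH, (explore EG x₀ (List.ofFn w)).vis = U ∧
      (explore EG x₀ (List.ofFn w)).used ⊆ F ∧
      r ^ #(explore EG x₀ (List.ofFn w)).used = ∏ i, instrWeight r (w i) := by
  have hpos : 0 < #U := Finset.card_pos.mpr ⟨x₀, hx₀⟩
  have hinv : ExploreInv H U F x₀ ⟨{x₀}, [x₀], ∅⟩ :=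
    { root := by simp
      stack_sub := by simp
      vis_sub := by simpa using hx₀
      used_sub := by simp
      used_ends := by simp
      saturated := fun x hx hx' => by simp at hx hx'; exact absurd hx hx' }
  obtain ⟨w, hw1, hw2, hw3, hw4⟩ := exists_instructions (SG := SG) (SH := SH) hEG hSG hSH r hF _
    ⟨{x₀}, [x₀], ∅⟩ rfl hinv
  have key : ∀ k : ℕ, (List.replicate k (none : Instr SG SH)).foldl (exploreStep EG)
      (w.foldl (exploreStep EG) ⟨{x₀}, [x₀], ∅⟩) = w.foldl (exploreStep EG) ⟨{x₀}, [x₀], ∅⟩ := by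
    intro k
    generalize w.foldl (exploreStep EG) ⟨{x₀}, [x₀], ∅⟩ = st at hw3
    obtain ⟨v, s, u⟩ := st
    obtain rfl : s = [] := hw3
    induction k with
    | zero => rfl
    | succ k ihk => rw [List.replicate_succ, List.foldl_cons]; exact ihk
  obtain ⟨w', hlen, hrun, hprod⟩ : ∃ w' : List (Instr SG SH), w'.length = Λ ∧
      explore EG x₀ w' = w.foldl (exploreStep EG) ⟨{x₀}, [x₀], ∅⟩ ∧
      (w'.map (instrWeight r)).prod = (w.map (instrWeight r)).prod := by
    refine ⟨w ++ List.replicate (Λ - w.length) none, ?_, ?_, ?_⟩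
    · simp at hw1
      simp
      omega
    · rw [explore, List.foldl_append, key]
    · simp [instrWeight]
  subst hlen
  refine ⟨w'.get, ?_, ?_, ?_⟩
  · rw [List.ofFn_get, hrun]
    apply subset_antisymm hw2.vis_sub
    intro y hy
    have hiff : ∀ a b, Relation.EqvGen (InnerRel H U F) a b →
        (a ∈ (w.foldl (exploreStep EG) ⟨{x₀}, [x₀], ∅⟩).vis ↔
          b ∈ (w.foldl (exploreStep EG) ⟨{x₀}, [x₀], ∅⟩).vis) := by
      intro a b hab
      induction hab with
      | rel a b h =>
        exact ⟨fun ha => hw2.saturated a ha (by rw [hw3]; simp) b (Or.inl h),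
          fun hb => hw2.saturated b hb (by rw [hw3]; simp) a (Or.inr h)⟩
      | refl a => rfl
      | symm a b _ h => exact h.symm
      | trans a b c _ _ h1 h2 => exact h1.trans h2
    exact (hiff _ _ (hconn y hy)).mp hw2.root
  · rw [List.ofFn_get, hrun]
    exact hw2.used_sub
  · rw [List.ofFn_get, hrun, hw4, ← hprod, ← List.prod_ofFn]
    have : (List.ofFn fun i => instrWeight r (w'.get i)) = w'.map (instrWeight r) := by
      rw [← List.ofFn_get (w'.map _)]
      simp
    rw [this]
    simp

end Explore

/-! ### The union bound -/

/-- If `n² (1 + d + 3d)^Λ (N choose β) (3/n)^β < 1`, some family of bijections is such that no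
connected vertex set `U` of the extension graph with at most `Λ / 2` vertices and at most `N`
candidate constraints spans `β` inter-cloud edges beyond a connecting set `F`. -/
theorem exists_sparse_family [Fintype VG] [Fintype VH] [DecidableEq VG] [DecidableEq VH]
    [Group VG] [Group VH] {G : SimpleGraph VG} {H : SimpleGraph VH} {EG : Finset (VG × VG)}
    (hEG : IsOrientation G EG) {SG : Finset VG} {SH : Finset VH}
    (hSG : ∀ a b, G.Adj a b ↔ a⁻¹ * b ∈ SG) (hSH : ∀ a b, H.Adj a b ↔ a⁻¹ * b ∈ SH)
    {Λ N β : ℕ}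
    (hsmall : (Fintype.card (VG × VH) : ℝ) * (1 + #SH + 3 * #SG) ^ Λ * N.choose β *
      (3 / Fintype.card VH) ^ β < 1) :
    ∃ M : VG × VG → VH ≃ VH, ∀ (U : Finset (VG × VH)) (F : Finset ((VG × VG) × VH × VH))
      (x₀ : VG × VH), x₀ ∈ U → (∀ c ∈ F, c.1 ∈ EG) → Extends M F →
      (∀ y ∈ U, Relation.EqvGen (InnerRel H U F) x₀ y) → 2 * #U ≤ Λ →
      #(candidates EG U) ≤ N →
      #{c ∈ candidates EG U | M c.1 c.2.1 = c.2.2 ∧ c ∉ F} < β := by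
  by_contra! hcon
  set r : ℝ := 3 / (Fintype.card VH : ℝ) with hr
  have hr0 : 0 ≤ r := by positivity
  set All : ℝ := (Fintype.card (VG × VG → VH ≃ VH) : ℝ) with hAll
  have hAllpos : 0 < All := by
    have : Nonempty (VG × VG → VH ≃ VH) := ⟨fun _ => Equiv.refl _⟩
    exact Nat.cast_pos.mpr Fintype.card_pos
  let good : VG × VH → Finset (Fin Λ → Instr SG SH) := fun x =>
    {w | #(candidates EG (explore EG x (List.ofFn w)).vis) ≤ N ∧
      r ^ #(explore EG x (List.ofFn w)).used = ∏ i, instrWeight r (w i)}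
  let ext : VG × VH → (Fin Λ → Instr SG SH) → Finset (Finset ((VG × VG) × VH × VH)) :=
    fun x w => ((candidates EG (explore EG x (List.ofFn w)).vis) \
      (explore EG x (List.ofFn w)).used).powersetCard β
  let fam : VG × VH → (Fin Λ → Instr SG SH) → Finset ((VG × VG) × VH × VH) →
      Finset (VG × VG → VH ≃ VH) :=
    fun x w E => {M | Extends M ((explore EG x (List.ofFn w)).used ∪ E)}
  have hcover : (univ : Finset (VG × VG → VH ≃ VH)) ⊆ (univ : Finset (VG × VH)).biUnion
      fun x => (good x).biUnion fun w => (ext x w).biUnion fun E => fam x w E := by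
    intro M _
    obtain ⟨U, F, x₀, hx₀, hF, hMF, hconn, hΛ, hN, hβ⟩ := hcon M
    obtain ⟨w, hvis, hused, hwt⟩ := explore_complete hEG hSG hSH r hF hx₀ hconn hΛ
    obtain ⟨E, hE, hEcard⟩ := Finset.exists_subset_card_eq hβ
    simp only [mem_biUnion, mem_univ, true_and]
    refine ⟨x₀, w, ?_, E, ?_, ?_⟩
    · simp only [good, mem_filter, mem_univ, true_and]
      exact ⟨by rwa [hvis], hwt⟩
    · simp only [ext, mem_powersetCard]
      refine ⟨fun c hc => ?_, hEcard⟩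
      have := Finset.mem_filter.mp (hE hc)
      rw [Finset.mem_sdiff, hvis]
      exact ⟨this.1, fun h => this.2.2 (hused h)⟩
    · simp only [fam, mem_filter, mem_univ, true_and]
      intro c hc
      rcases Finset.mem_union.mp hc with hc | hc
      · exact hMF c (hused hc)
      · exact (Finset.mem_filter.mp (hE hc)).2.1
  have hfam : ∀ x, ∀ w ∈ good x, ∀ E ∈ ext x w,
      (#(fam x w E) : ℝ) ≤ (∏ i, instrWeight r (w i)) * r ^ β * All := by
    intro x w hw E hE
    simp only [good, mem_filter, mem_univ, true_and] at hw
    simp only [ext, mem_powersetCard] at hE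
    have hdisj : Disjoint (explore EG x (List.ofFn w)).used E :=
      Finset.disjoint_left.mpr fun c hc hcE => (Finset.mem_sdiff.mp (hE.1 hcE)).2 hc
    have := card_extends_le ((explore EG x (List.ofFn w)).used ∪ E)
    rw [Finset.card_union_of_disjoint hdisj, pow_add, hE.2, hw.2] at this
    exact this
  have hwtpos : ∀ w : Fin Λ → Instr SG SH, 0 ≤ ∏ i, instrWeight r (w i) := by
    intro w
    apply Finset.prod_nonneg
    intro i _
    unfold instrWeight
    split <;> positivity
  have hext : ∀ x, ∀ w ∈ good x, (#(ext x w) : ℝ) ≤ N.choose β := by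
    intro x w hw
    simp only [good, mem_filter, mem_univ, true_and] at hw
    simp only [ext, card_powersetCard]
    exact_mod_cast Nat.choose_le_choose β ((Finset.card_le_card Finset.sdiff_subset).trans hw.1)
  have hsum : All ≤ ∑ x : VG × VH, ∑ w ∈ good x, ∑ E ∈ ext x w, (#(fam x w E) : ℝ) := by
    have h1 : Fintype.card (VG × VG → VH ≃ VH) ≤
        ∑ x : VG × VH, ∑ w ∈ good x, ∑ E ∈ ext x w, #(fam x w E) := by
      rw [← Finset.card_univ]
      refine (Finset.card_le_card hcover).trans (card_biUnion_le.trans ?_)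
      refine Finset.sum_le_sum fun x _ => card_biUnion_le.trans ?_
      exact Finset.sum_le_sum fun w _ => card_biUnion_le
    rw [hAll]
    exact_mod_cast h1
  have hcardH : (Fintype.card VH : ℝ) * r ≤ 3 := by
    rcases Nat.eq_zero_or_pos (Fintype.card VH) with h0 | h0
    · rw [h0]; norm_num
    · rw [hr]
      have : (0 : ℝ) < Fintype.card VH := by exact_mod_cast h0
      field_simp
      rfl
  have hbound : ∑ x : VG × VH, ∑ w ∈ good x, ∑ E ∈ ext x w, (#(fam x w E) : ℝ) ≤
      ((Fintype.card (VG × VH) : ℝ) * (1 + #SH + 3 * #SG) ^ Λ * N.choose β * r ^ β) * All := by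
    calc _ ≤ ∑ x : VG × VH, ∑ w ∈ good x,
          N.choose β * ((∏ i, instrWeight r (w i)) * r ^ β * All) := by
          refine Finset.sum_le_sum fun x _ => Finset.sum_le_sum fun w hw => ?_
          refine (Finset.sum_le_sum (hfam x w hw)).trans ?_
          rw [Finset.sum_const, nsmul_eq_mul]
          have := hwtpos w
          exact mul_le_mul_of_nonneg_right (hext x w hw) (by positivity)
      _ ≤ ∑ x : VG × VH, ∑ w : Fin Λ → Instr SG SH,
          N.choose β * ((∏ i, instrWeight r (w i)) * r ^ β * All) := by
          refine Finset.sum_le_sum fun x _ => Finset.sum_le_sum_of_subset_of_nonneg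
            (Finset.subset_univ _) fun w _ _ => ?_
          have := hwtpos w
          positivity
      _ = ((Fintype.card (VG × VH) : ℝ) * (1 + #SH + #SG * Fintype.card VH * r) ^ Λ *
          N.choose β * r ^ β) * All := by
          rw [← sum_instrWeight SG SH r, Fintype.sum_pow, Finset.sum_const, Finset.card_univ,
            nsmul_eq_mul]
          simp only [Finset.mul_sum, Finset.sum_mul]
          exact Finset.sum_congr rfl fun w _ => by ring
      _ ≤ _ := by
          have : (#SG : ℝ) * Fintype.card VH * r ≤ 3 * #SG := by
            calc (#SG : ℝ) * Fintype.card VH * r = #SG * (Fintype.card VH * r) := by ring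
              _ ≤ #SG * 3 := by gcongr
              _ = _ := by ring
          gcongr
  nlinarith [hsum.trans hbound]

/-! ### Spanning forests and cycle spaces modulo two -/

/-- A set `Z` of labelled edges over a base relation `R` contains a subset `F` with the same
reachability and there is a potential which is constant along `R` and has the labels of all
edges of `Z` as differences up to a subspace whose dimension is at most the number of edges
outside `F`. -/
theorem exists_forest_potential {X ι C : Type*} [DecidableEq ι] [AddCommGroup C]
    [Module (ZMod 2) C] [FiniteDimensional (ZMod 2) C] (R : X → X → Prop) (a b : ι → X)
    (l : ι → C) (Z : Finset ι) :
    ∃ F ⊆ Z, ∃ (φ : X → C) (W : Submodule (ZMod 2) C),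
      Module.finrank (ZMod 2) W ≤ #(Z \ F) ∧ (∀ x y, R x y → φ x = φ y) ∧
      (∀ z ∈ Z, φ (a z) + φ (b z) + l z ∈ W) ∧
      ∀ z ∈ Z, Relation.EqvGen (fun x y => R x y ∨ ∃ c ∈ F, x = a c ∧ y = b c) (a z) (b z) := by
  classical
  induction Z using Finset.induction_on with
  | empty => exact ⟨∅, by simp, fun _ => 0, ⊥, by simp, by simp, by simp, by simp⟩
  | insert z Z hz ih =>
    obtain ⟨F, hFZ, φ, W, hW, hR, hl, hconn⟩ := ih
    set R' : X → X → Prop := fun x y => R x y ∨ ∃ c ∈ F, x = a c ∧ y = b c with hR'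
    set δ : C := φ (a z) + φ (b z) + l z with hδ
    have hzF : z ∉ F := fun h => hz (hFZ h)
    by_cases hab : Relation.EqvGen R' (a z) (b z)
    · refine ⟨F, hFZ.trans (Finset.subset_insert _ _), φ, W ⊔ Submodule.span (ZMod 2) {δ},
        ?_, hR, ?_, ?_⟩
      · rw [Finset.insert_sdiff_of_notMem _ hzF, Finset.card_insert_of_notMem
          (fun h => hz (Finset.mem_sdiff.mp h).1)]
        have h1 := Submodule.finrank_add_le_finrank_add_finrank W (Submodule.span (ZMod 2) {δ})
        have h2 := finrank_span_le_card (R := ZMod 2) ({δ} : Set C)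
        simp only [Set.toFinset_singleton, card_singleton] at h2
        omega
      · intro c hc
        rcases Finset.mem_insert.mp hc with rfl | hc
        · exact Submodule.mem_sup_right (Submodule.mem_span_singleton_self δ)
        · exact Submodule.mem_sup_left (hl c hc)
      · intro c hc
        rcases Finset.mem_insert.mp hc with rfl | hc
        · exact hab
        · exact hconn c hc
    · have hmono : ∀ x y, R' x y → R x y ∨ ∃ c ∈ insert z F, x = a c ∧ y = b c := by
        rintro x y (h | ⟨c, hc, h⟩)
        · exact Or.inl h
        · exact Or.inr ⟨c, Finset.mem_insert_of_mem hc, h⟩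
      refine ⟨insert z F, Finset.insert_subset_insert z hFZ,
        fun x => φ x + if Relation.EqvGen R' (a z) x then δ else 0, W, ?_, ?_, ?_, ?_⟩
      · rwa [Finset.insert_sdiff_insert, Finset.sdiff_insert_of_notMem hz]
      · intro x y hxy
        have h1 : Relation.EqvGen R' x y := Relation.EqvGen.rel _ _ (Or.inl hxy)
        have h2 : Relation.EqvGen R' (a z) x ↔ Relation.EqvGen R' (a z) y :=
          ⟨fun h => h.trans _ _ _ h1, fun h => h.trans _ _ _ (h1.symm _ _)⟩
        simp only [hR x y hxy, h2]
      · intro c hc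
        rcases Finset.mem_insert.mp hc with rfl | hc
        · simp only [hab, if_false, Relation.EqvGen.refl (a c), if_true, add_zero]
          have : φ (a c) + δ + φ (b c) + l c = δ + δ := by rw [hδ]; abel
          rw [this, ZModModule.add_self]
          exact W.zero_mem
        · have h1 := hconn c hc
          have h2 : Relation.EqvGen R' (a z) (a c) ↔ Relation.EqvGen R' (a z) (b c) :=
            ⟨fun h => h.trans _ _ _ h1, fun h => h.trans _ _ _ (h1.symm _ _)⟩
          have h3 := hl c hc
          simp only [h2]
          have h4 : ∀ t : C, φ (a c) + t + (φ (b c) + t) + l c = φ (a c) + φ (b c) + l c := by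
            intro t
            have : φ (a c) + t + (φ (b c) + t) + l c = φ (a c) + φ (b c) + l c + (t + t) := by
              abel
            rw [this, ZModModule.add_self, add_zero]
          rw [h4]
          exact h3
      · intro c hc
        rcases Finset.mem_insert.mp hc with rfl | hc
        · exact Relation.EqvGen.rel _ _ (Or.inr ⟨c, Finset.mem_insert_self _ _, rfl, rfl⟩)
        · exact (hconn c hc).mono hmono

/-- The number of traversals modulo two of every edge by a walk. -/
def walkChain {V : Type} [DecidableEq V] {G : SimpleGraph V} {u v : V} (w : G.Walk u v) :
    Sym2 V → ZMod 2 := fun e => (w.edges.count e : ZMod 2)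

section Chain

variable {V : Type} [DecidableEq V] {G : SimpleGraph V}

@[simp]
theorem walkChain_nil (u : V) : walkChain (SimpleGraph.Walk.nil : G.Walk u u) = 0 := by
  ext e
  simp [walkChain]

@[simp]
theorem walkChain_cons {u v w : V} (h : G.Adj u v) (p : G.Walk v w) :
    walkChain (SimpleGraph.Walk.cons h p) = Pi.single s(u, v) 1 + walkChain p := by
  ext e
  simp only [walkChain, SimpleGraph.Walk.edges_cons, List.count_cons, Pi.add_apply,
    Pi.single_apply]
  by_cases he : e = s(u, v)
  · subst he; simp [add_comm]
  · have : ¬ s(u, v) = e := fun h => he h.symm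
    simp [he, this]

theorem walkChain_append {u v w : V} (p : G.Walk u v) (q : G.Walk v w) :
    walkChain (p.append q) = walkChain p + walkChain q := by
  ext e
  simp [walkChain, SimpleGraph.Walk.edges_append]

theorem walkChain_reverse {u v : V} (p : G.Walk u v) : walkChain p.reverse = walkChain p := by
  ext e
  simp [walkChain, SimpleGraph.Walk.edges_reverse]

theorem walkChain_apply_of_isBridge {a b : V} (hbr : G.IsBridge s(a, b)) {u v : V}
    (w : G.Walk u v) [DecidablePred ((G.deleteEdges {s(a, b)}).Reachable a)] :
    walkChain w s(a, b) = (if (G.deleteEdges {s(a, b)}).Reachable a u then 1 else 0) +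
      (if (G.deleteEdges {s(a, b)}).Reachable a v then 1 else 0) := by
  rw [SimpleGraph.isBridge_iff] at hbr
  induction w with
  | nil => simp [ZModModule.add_self]
  | @cons u v' v hadj p ih =>
    rw [walkChain_cons, Pi.add_apply, ih]
    by_cases he : s(u, v') = s(a, b)
    · rw [he, Pi.single_eq_same]
      have hra : (G.deleteEdges {s(a, b)}).Reachable a a := SimpleGraph.Reachable.refl a
      rcases Sym2.eq_iff.mp he with ⟨rfl, rfl⟩ | ⟨rfl, rfl⟩
      · simp [hbr]
      · simp only [hbr, hra, if_true, if_false]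
        rw [← add_assoc, ZModModule.add_self]
    · rw [Pi.single_eq_of_ne (fun h => he h.symm), zero_add]
      have hadj' : (G.deleteEdges {s(a, b)}).Adj u v' := by
        rw [SimpleGraph.deleteEdges_adj]
        exact ⟨hadj, he⟩
      have : (G.deleteEdges {s(a, b)}).Reachable a u ↔
          (G.deleteEdges {s(a, b)}).Reachable a v' :=
        ⟨fun h => h.trans hadj'.reachable, fun h => h.trans hadj'.symm.reachable⟩
      simp only [this]

/-- A closed walk shorter than the girth traverses every edge an even number of times. -/
theorem walkChain_eq_zero_of_length_lt {u : V} (w : G.Walk u u)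
    (hw : ∀ (v : V) (c : G.Walk v v), c.IsCycle → w.length < c.length) : walkChain w = 0 := by
  classical
  set G' : SimpleGraph V := SimpleGraph.fromEdgeSet {e | e ∈ w.edges} with hG'
  have hle : G' ≤ G := by
    intro x y hxy
    rw [hG', SimpleGraph.fromEdgeSet_adj] at hxy
    exact w.adj_of_mem_edges hxy.1
  have hacyc : G'.IsAcyclic := by
    intro v c hc
    have h1 := hw v (c.mapLe hle) (hc.mapLe hle)
    have h2 : c.edges ⊆ w.edges := by
      intro e he
      have := c.edges_subset_edgeSet he
      rw [hG', SimpleGraph.edgeSet_fromEdgeSet] at this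
      exact this.1
    have h3 := (hc.edges_nodup.subperm h2).length_le
    simp only [SimpleGraph.Walk.length_edges] at h3
    have h4 : (c.mapLe hle).length = c.length := by simp [SimpleGraph.Walk.mapLe]
    omega
  have htr : ∀ e ∈ w.edges, e ∈ G'.edgeSet := by
    intro e he
    rw [hG', SimpleGraph.edgeSet_fromEdgeSet]
    exact ⟨he, fun h => G.not_isDiag_of_mem_edgeSet (w.edges_subset_edgeSet he) h⟩
  have hchain : walkChain (w.transfer G' htr) = walkChain w := by
    ext e
    simp [walkChain]
  rw [← hchain]
  ext e
  by_cases he : e ∈ (w.transfer G' htr).edges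
  · have hbr := SimpleGraph.isAcyclic_iff_forall_isBridge.mp hacyc
      ((w.transfer G' htr).edges_subset_edgeSet he)
    induction e with
    | _ a b =>
      rw [walkChain_apply_of_isBridge hbr, ZModModule.add_self]
      rfl
  · have h0 := List.count_eq_zero_of_not_mem he
    simp only [walkChain, h0, Nat.cast_zero, Pi.zero_apply]

end Chain

/-! ### Walks in the extension graph -/

section Walks

variable {G : SimpleGraph VG} {H : SimpleGraph VH} {EG : Finset (VG × VG)}
  {M : VG × VG → VH ≃ VH}

theorem adj_of_extGraph_adj (hEG : IsOrientation G EG) {x y : VG × VH}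
    (hxy : (ExtGraph H EG M).Adj x y) (hne : x.1 ≠ y.1) : G.Adj x.1 y.1 := by
  rw [ExtGraph, SimpleGraph.fromRel_adj] at hxy
  rcases hxy.2 with (⟨h, -⟩ | ⟨h, -⟩) | (⟨h, -⟩ | ⟨h, -⟩)
  · exact absurd h hne
  · exact hEG.1 _ h
  · exact absurd h.symm hne
  · exact (hEG.1 _ h).symm

variable [DecidableEq VG]

/-- The edge of the base graph under an edge of the extension graph, as a chain. -/
def projLabel (x y : VG × VH) : Sym2 VG → ZMod 2 :=
  if x.1 = y.1 then 0 else Pi.single s(x.1, y.1) 1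

theorem extLen_mk (n : ℕ) (x y : VG × VH) :
    extLen n s(x, y) = if x.1 = y.1 then Real.log n ^ ((1 : ℝ) / 3)
      else Real.log n ^ ((2 : ℝ) / 3) := by
  simp [extLen]

theorem extLen_nonneg (n : ℕ) (e : Sym2 (VG × VH)) : 0 ≤ extLen n e := by
  have := Real.log_natCast_nonneg n
  unfold extLen
  split_ifs <;> positivity

theorem le_extLen {n : ℕ} (hL : 1 ≤ Real.log n) (e : Sym2 (VG × VH)) :
    Real.log n ^ ((1 : ℝ) / 3) ≤ extLen n e := by
  unfold extLen
  split_ifs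
  · exact le_rfl
  · exact Real.rpow_le_rpow_of_exponent_le hL (by norm_num)

theorem walkCost_cons {V : Type} {Gr : SimpleGraph V} (ℓ : Sym2 V → ℝ) {u v w : V}
    (h : Gr.Adj u v) (p : Gr.Walk v w) :
    walkCost ℓ (SimpleGraph.Walk.cons h p) = ℓ s(u, v) + walkCost ℓ p := by
  simp [walkCost]

theorem walkCost_nonneg {V : Type} {Gr : SimpleGraph V} {ℓ : Sym2 V → ℝ} (hℓ : ∀ e, 0 ≤ ℓ e)
    {u v : V} (p : Gr.Walk u v) : 0 ≤ walkCost ℓ p :=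
  List.sum_nonneg (by simp only [List.mem_map]; rintro _ ⟨e, -, rfl⟩; exact hℓ e)

theorem length_mul_le_walkCost {n : ℕ} (hL : 1 ≤ Real.log n) {x y : VG × VH}
    (p : (ExtGraph H EG M).Walk x y) :
    (p.length : ℝ) * Real.log n ^ ((1 : ℝ) / 3) ≤ walkCost (extLen n) p := by
  induction p with
  | nil => simp [walkCost]
  | @cons u v w h p ih =>
    rw [walkCost_cons, SimpleGraph.Walk.length_cons]
    push_cast
    linarith [le_extLen hL s(u, v)]

/-- The projection of a walk of the extension graph to the base graph. -/
theorem exists_projection (hEG : IsOrientation G EG) (n : ℕ) {x y : VG × VH}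
    (p : (ExtGraph H EG M).Walk x y) :
    ∃ w : G.Walk x.1 y.1, (w.length : ℝ) * Real.log n ^ ((2 : ℝ) / 3) ≤ walkCost (extLen n) p ∧
      (∀ z ∈ p.support, z.1 ∈ w.support) ∧
      ∀ (φ : VG × VH → Sym2 VG → ZMod 2) (W : Submodule (ZMod 2) (Sym2 VG → ZMod 2)),
        (∀ a ∈ p.support, ∀ b ∈ p.support, (ExtGraph H EG M).Adj a b →
          φ a + φ b + projLabel a b ∈ W) → φ x + φ y + walkChain w ∈ W := by
  induction p with
  | nil =>
    refine ⟨SimpleGraph.Walk.nil, by simp [walkCost], by simp, fun φ W _ => ?_⟩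
    rw [ZModModule.add_self, walkChain_nil, add_zero]
    exact W.zero_mem
  | @cons x v y h p ih =>
    obtain ⟨w, hw1, hw2, hw3⟩ := ih
    have key : ∀ φ : VG × VH → Sym2 VG → ZMod 2, φ x + φ v + (φ v + φ y) = φ x + φ y := by
      intro φ
      have : φ x + φ v + (φ v + φ y) = φ x + φ y + (φ v + φ v) := by abel
      rw [this, ZModModule.add_self, add_zero]
    by_cases hxv : x.1 = v.1
    · refine ⟨w.copy hxv.symm rfl, ?_, ?_, ?_⟩
      · rw [walkCost_cons, SimpleGraph.Walk.length_copy]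
        linarith [extLen_nonneg n s(x, v)]
      · intro z hz
        rw [SimpleGraph.Walk.support_copy]
        rw [SimpleGraph.Walk.support_cons, List.mem_cons] at hz
        rcases hz with rfl | hz
        · rw [hxv]; exact w.start_mem_support
        · exact hw2 z hz
      · intro φ W hφ
        have h1 := hw3 φ W fun a ha b hb => hφ a (by simp [ha]) b (by simp [hb])
        have h2 := hφ x (by simp) v (by simp) h
        have h3 : walkChain (w.copy hxv.symm rfl) = walkChain w := by
          ext e; simp [walkChain]
        rw [projLabel, if_pos hxv, add_zero] at h2
        have := W.add_mem h2 h1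
        rwa [← add_assoc, key, ← h3] at this
    · refine ⟨SimpleGraph.Walk.cons (adj_of_extGraph_adj hEG h hxv) w, ?_, ?_, ?_⟩
      · rw [walkCost_cons, SimpleGraph.Walk.length_cons, extLen_mk, if_neg hxv]
        push_cast
        linarith
      · intro z hz
        rw [SimpleGraph.Walk.support_cons, List.mem_cons] at hz ⊢
        rcases hz with rfl | hz
        · exact Or.inl rfl
        · exact Or.inr (hw2 z hz)
      · intro φ W hφ
        have h1 := hw3 φ W fun a ha b hb => hφ a (by simp [ha]) b (by simp [hb])
        have h2 := hφ x (by simp) v (by simp) h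
        rw [projLabel, if_neg hxv] at h2
        have := W.add_mem h2 h1
        have h4 : φ x + φ v + Pi.single s(x.1, v.1) 1 + (φ v + φ y + walkChain w) =
            φ x + φ v + (φ v + φ y) + (Pi.single s(x.1, v.1) 1 + walkChain w) := by abel
        rwa [h4, key, ← walkChain_cons] at this

theorem extGraph_preconnected (hEG : IsOrientation G EG) (hG : G.Connected) (hH : H.Connected) :
    (ExtGraph H EG M).Preconnected := by
  have hcloud : ∀ (g : VG) (a b : VH), (ExtGraph H EG M).Reachable (g, a) (g, b) := by
    intro g a b
    obtain ⟨p⟩ := hH.preconnected a b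
    induction p with
    | nil => exact SimpleGraph.Reachable.refl _
    | @cons a v b h p ih =>
      refine SimpleGraph.Reachable.trans (SimpleGraph.Adj.reachable ?_) ih
      rw [ExtGraph, SimpleGraph.fromRel_adj]
      exact ⟨fun hc => h.ne (Prod.ext_iff.mp hc).2, Or.inl (Or.inl ⟨rfl, h⟩)⟩
  have hstep : ∀ (g g' : VG) (a : VH), G.Walk g g' →
      ∃ b, (ExtGraph H EG M).Reachable (g, a) (g', b) := by
    intro g g' a p
    induction p generalizing a with
    | nil => exact ⟨a, SimpleGraph.Reachable.refl _⟩
    | @cons g v g' h p ih =>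
      have : ∃ b, (ExtGraph H EG M).Adj (g, a) (v, b) := by
        by_cases hc : (g, v) ∈ EG
        · refine ⟨M (g, v) a, ?_⟩
          rw [ExtGraph, SimpleGraph.fromRel_adj]
          exact ⟨fun hc => h.ne (Prod.ext_iff.mp hc).1, Or.inl (Or.inr ⟨hc, rfl⟩)⟩
        · have hc' : (v, g) ∈ EG := (hEG.2 v g h.symm).mpr hc
          refine ⟨(M (v, g)).symm a, ?_⟩
          rw [ExtGraph, SimpleGraph.fromRel_adj]
          exact ⟨fun hc => h.ne (Prod.ext_iff.mp hc).1, Or.inr (Or.inr ⟨hc', by simp⟩)⟩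
      obtain ⟨b, hb⟩ := this
      obtain ⟨c, hc⟩ := ih b
      exact ⟨c, hb.reachable.trans hc⟩
  rintro ⟨g, a⟩ ⟨g', b⟩
  obtain ⟨p⟩ := hG.preconnected g g'
  obtain ⟨c, hc⟩ := hstep g g' a p
  exact hc.trans (hcloud g' c b)

variable [DecidableEq VH]

/-- Every two terminals are joined by a walk of cost at most their distance. -/
theorem exists_walk_le_instD (hX : (ExtGraph H EG M).Preconnected) {n : ℕ}
    (hL : 1 ≤ Real.log n) (u v : VG × VH) :
    ∃ p : (ExtGraph H EG M).Walk u v,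
      walkCost (extLen n) p ≤ instD n H EG M (Sum.inr u) (Sum.inr v) := by
  by_cases huv : u = v
  · subst huv
    exact ⟨SimpleGraph.Walk.nil, by simp [walkCost, instD]⟩
  · obtain ⟨q⟩ := hX u v
    have hne : {r : ℝ | ∃ p : (ExtGraph H EG M).Walk u v, r = walkCost (extLen n) p}.Nonempty :=
      ⟨_, q, rfl⟩
    obtain ⟨r, ⟨p, rfl⟩, hr⟩ := Real.lt_sInf_add_pos hne
      (show 0 < 2 * Real.log n by linarith)
    refine ⟨p, ?_⟩
    simp only [instD, huv, if_false, extDist, spDist]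
    exact hr.le

theorem instD_nonneg {n : ℕ} (a b : IV VG VH) : 0 ≤ instD n H EG M a b := by
  unfold instD
  split
  · split_ifs
    · exact le_rfl
    · refine add_nonneg (Real.sInf_nonneg ?_) ?_
      · rintro r ⟨p, rfl⟩
        exact walkCost_nonneg (extLen_nonneg n) p
      · have := Real.log_natCast_nonneg n
        positivity
  · exact le_rfl

theorem two_mul_log_le_instD {n : ℕ} {u v : VG × VH} (huv : u ≠ v) :
    2 * Real.log n ≤ instD n H EG M (Sum.inr u) (Sum.inr v) := by
  simp only [instD, huv, if_false]
  have : 0 ≤ extDist n H EG M u v := by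
    refine Real.sInf_nonneg ?_
    rintro r ⟨p, rfl⟩
    exact walkCost_nonneg (extLen_nonneg n) p
  linarith

theorem dist_mul_le_instD (hEG : IsOrientation G EG) (hX : (ExtGraph H EG M).Preconnected)
    {n : ℕ} (hL : 1 ≤ Real.log n) (u v : VG × VH) :
    (G.dist u.1 v.1 : ℝ) * Real.log n ^ ((2 : ℝ) / 3) ≤
      instD n H EG M (Sum.inr u) (Sum.inr v) := by
  obtain ⟨p, hp⟩ := exists_walk_le_instD hX hL u v
  obtain ⟨w, hw, -⟩ := exists_projection hEG n p
  refine le_trans ?_ (hw.trans hp)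
  have : (G.dist u.1 v.1 : ℝ) ≤ w.length := by exact_mod_cast SimpleGraph.dist_le w
  gcongr

end Walks

/-! ### Partitions of expanders -/

theorem card_cut_le_two_mul {α : Type*} [DecidableEq α] {V : Type} [Fintype V]
    {G : SimpleGraph V} {EO : Finset (V × V)} (hEO : IsOrientation G EO) (c : V → α) :
    {p : V × V | G.Adj p.1 p.2 ∧ c p.1 ≠ c p.2}.ncard ≤ 2 * #{p ∈ EO | c p.1 ≠ c p.2} := by
  classical
  have hsub : {p : V × V | G.Adj p.1 p.2 ∧ c p.1 ≠ c p.2} ⊆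
      ((({p ∈ EO | c p.1 ≠ c p.2} ∪ {p ∈ EO | c p.1 ≠ c p.2}.image Prod.swap) :
        Finset (V × V)) : Set (V × V)) := by
    rintro ⟨a, b⟩ ⟨hab, hc⟩
    simp only [coe_union, coe_filter, coe_image, Set.mem_union, Set.mem_ofPred_eq, Set.mem_image]
    by_cases h : (a, b) ∈ EO
    · exact Or.inl ⟨h, hc⟩
    · exact Or.inr ⟨(b, a), ⟨(hEO.2 b a hab.symm).mpr h, fun h => hc h.symm⟩, rfl⟩
  calc _ ≤ _ := Set.ncard_le_ncard hsub (Finset.finite_toSet _)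
    _ = _ := Set.ncard_coe_finset _
    _ ≤ _ := card_union_le _ _
    _ ≤ _ := by
      have := card_image_le (s := {p ∈ EO | c p.1 ≠ c p.2}) (f := Prod.swap)
      omega

/-- In an expander, a partition cutting few edges has a part missing few vertices. -/
theorem exists_large_fiber {V : Type} [Fintype V] [Nonempty V] {α : Type*} [DecidableEq α]
    {G : SimpleGraph V} {h : ℝ} (hh : 0 ≤ h) (hG : EdgeExpansionAtLeast G h)
    {EO : Finset (V × V)} (hEO : IsOrientation G EO) (c : V → α) :
    ∃ a, h * (Fintype.card V - #{v | c v = a} : ℝ) ≤ 2 * #{p ∈ EO | c p.1 ≠ c p.2} := by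
  classical
  suffices hs : ∃ a, h * (Fintype.card V - #{v | c v = a} : ℝ) ≤
      ({p : V × V | G.Adj p.1 p.2 ∧ c p.1 ≠ c p.2}.ncard : ℝ) by
    obtain ⟨a, ha⟩ := hs
    exact ⟨a, ha.trans (by exact_mod_cast card_cut_le_two_mul hEO c)⟩
  by_cases hbig : ∃ a, Fintype.card V < 2 * #{v | c v = a}
  · obtain ⟨a, ha⟩ := hbig
    refine ⟨a, ?_⟩
    have h1 := card_filter_add_card_filter_not (s := (univ : Finset V)) (fun v => c v = a)
    rw [card_univ] at h1
    have h2 := hG {v | ¬ c v = a} (by omega)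
    have h3 : (Fintype.card V - #{v | c v = a} : ℝ) = #{v | ¬ c v = a} := by
      rw [← h1]; push_cast; ring
    rw [h3]
    refine h2.trans ?_
    norm_cast
    refine Set.ncard_le_ncard ?_ (Set.toFinite _)
    rintro p ⟨hp, h4, h5⟩
    simp only [mem_filter, mem_univ, true_and, not_not] at h4 h5
    exact ⟨hp, fun h => h4 (h.trans h5)⟩
  · push Not at hbig
    obtain ⟨v₀⟩ := ‹Nonempty V›
    refine ⟨c v₀, ?_⟩
    set s : Finset (V × V) := {p | G.Adj p.1 p.2 ∧ c p.1 ≠ c p.2} with hs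
    have hcard : {p : V × V | G.Adj p.1 p.2 ∧ c p.1 ≠ c p.2}.ncard = #s := by
      rw [← Set.ncard_coe_finset]; congr 1; ext p; simp [hs]
    have h1 : #s = ∑ a ∈ univ.image c, #{p ∈ s | c p.1 = a} :=
      card_eq_sum_card_fiberwise (f := fun p : V × V => c p.1) fun p _ => by simp
    have h2 : Fintype.card V = ∑ a ∈ univ.image c, #{v | c v = a} := by
      rw [← card_univ]
      exact card_eq_sum_card_fiberwise (f := c) fun p _ => by simp
    have h3 : h * (Fintype.card V : ℝ) ≤ #s := by
      rw [h1, h2]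
      push_cast
      rw [mul_sum]
      refine sum_le_sum fun a _ => ?_
      refine (hG _ (hbig a)).trans ?_
      rw [← Set.ncard_coe_finset, Nat.cast_le]
      refine Set.ncard_le_ncard ?_ (Finset.finite_toSet _)
      rintro p ⟨hp, h4, h5⟩
      simp only [mem_filter, mem_univ, true_and] at h4 h5
      simp only [hs, coe_filter, mem_filter, mem_univ, true_and, Set.mem_ofPred_eq]
      exact ⟨⟨hp, fun h => h5 (h ▸ h4)⟩, h4⟩
    rw [hcard]
    have : (0 : ℝ) ≤ #{v | c v = c v₀} := Nat.cast_nonneg _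
    nlinarith

/-! ### The structure of cheap integral solutions -/

theorem instW_nonneg [DecidableEq VG] (n : ℕ) (p : IV VG VH × IV VG VH) : 0 ≤ instW n p := by
  have := Real.log_natCast_nonneg n
  unfold instW
  split
  · split_ifs <;> positivity
  · positivity
  · exact le_rfl

section Cheap

variable [Fintype VG] [Fintype VH] [DecidableEq VG] [DecidableEq VH]
  {G : SimpleGraph VG} {H : SimpleGraph VH} {EG : Finset (VG × VG)} {EH : Finset (VH × VH)}
  {M : VG × VG → VH ≃ VH}

/-- The distance of two terminals. -/
abbrev termDist (n : ℕ) (H : SimpleGraph VH) (EG : Finset (VG × VG)) (M : VG × VG → VH ≃ VH)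
    (u v : VG × VH) : ℝ := instD n H EG M (Sum.inr u) (Sum.inr v)

/-- The cost of any injectively parametrized family of edges bounds the cost from below. -/
theorem sum_le_intCost {ι : Type*} (n : ℕ) (s : Finset ι) (φ : ι → IV VG VH × IV VG VH)
    (hφ : Set.InjOn φ s) (hs : ∀ i ∈ s, φ i ∈ instEdges EH EG M) (f : IV VG VH → IV VG VH) :
    ∑ i ∈ s, instW n (φ i) * instD n H EG M (f (φ i).1) (f (φ i).2) ≤
      intCost n H EH EG M f := by
  classical
  rw [intCost, ← sum_image (f := fun p => instW n p * instD n H EG M (f p.1) (f p.2)) hφ]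
  refine sum_le_sum_of_subset_of_nonneg ?_ fun p _ _ =>
    mul_nonneg (instW_nonneg n p) (instD_nonneg _ _)
  intro p hp
  obtain ⟨i, hi, rfl⟩ := mem_image.mp hp
  exact hs i hi

theorem intra_cost_le (n : ℕ) {f : IV VG VH → IV VG VH} {F : VG × VH → VG × VH}
    (hF : ∀ x, f (Sum.inl x) = Sum.inr (F x)) :
    ∑ g, ∑ p ∈ EH, (Real.log n ^ ((1 : ℝ) / 3))⁻¹ *
      termDist n H EG M (F (g, p.1)) (F (g, p.2)) ≤ intCost n H EH EG M f := by
  have := sum_le_intCost (H := H) (M := M) (EG := EG) (EH := EH) n (univ ×ˢ EH)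
    (fun p : VG × VH × VH => ((Sum.inl (p.1, p.2.1) : IV VG VH), Sum.inl (p.1, p.2.2)))
    (by rintro ⟨a, b, c⟩ - ⟨a', b', c'⟩ - h; simp at h; aesop)
    (by intro p hp; simp only [instEdges, mem_union]
        exact Or.inl (Or.inl (mem_image_of_mem _ hp))) f
  rw [sum_product] at this
  simpa only [instW, hF, if_true] using this

theorem inter_cost_le (hEG : IsOrientation G EG) (n : ℕ) {f : IV VG VH → IV VG VH}
    {F : VG × VH → VG × VH} (hF : ∀ x, f (Sum.inl x) = Sum.inr (F x)) :
    ∑ e ∈ EG, ∑ a, (Real.log n ^ ((2 : ℝ) / 3))⁻¹ *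
      termDist n H EG M (F (e.1, a)) (F (e.2, M e a)) ≤ intCost n H EH EG M f := by
  have := sum_le_intCost (H := H) (M := M) (EG := EG) (EH := EH) n (EG ×ˢ univ)
    (fun p : (VG × VG) × VH => ((Sum.inl (p.1.1, p.2) : IV VG VH), Sum.inl (p.1.2, M p.1 p.2)))
    (by rintro ⟨⟨a, b⟩, c⟩ - ⟨⟨a', b'⟩, c'⟩ - h; simp at h; aesop)
    (by intro p hp; simp only [instEdges, mem_union]
        exact Or.inl (Or.inr (mem_image_of_mem _ hp))) f
  rw [sum_product] at this
  refine le_trans (le_of_eq ?_) this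
  refine sum_congr rfl fun e he => sum_congr rfl fun a _ => ?_
  simp only [instW, hF, if_neg (hEG.1 e he).ne]

theorem pendant_cost_le (n : ℕ) {f : IV VG VH → IV VG VH} (hf : IsIntegralSolution f)
    {F : VG × VH → VG × VH} (hF : ∀ x, f (Sum.inl x) = Sum.inr (F x)) :
    ∑ g, ∑ a, (Real.log n)⁻¹ * termDist n H EG M (F (g, a)) (g, a) ≤
      intCost n H EH EG M f := by
  have := sum_le_intCost (H := H) (M := M) (EG := EG) (EH := EH) n univ
    (fun x : VG × VH => ((Sum.inl x : IV VG VH), (Sum.inr x : IV VG VH)))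
    (by rintro x - y - h; simpa using h)
    (by intro p hp; simp only [instEdges, mem_union]
        exact Or.inr (mem_image_of_mem _ hp)) f
  rw [← univ_product_univ, sum_product] at this
  simpa only [instW, hF, hf.2] using this

/-- A cheap integral solution is, outside few clouds, close to a map defined on the clouds,
which moves clouds by little and has small total stretch. -/
theorem exists_cloud_map {n : ℕ} {h ε K : ℝ} (hh : 0 < h) (hε : 0 < ε)
    (hVH : Fintype.card VH = n) (hn : 0 < n)
    (hL : 1 ≤ Real.log n) (hEG : IsOrientation G EG) (hEH : IsOrientation H EH)
    (hX : (ExtGraph H EG M).Preconnected) (hH : EdgeExpansionAtLeast H h)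
    {f : IV VG VH → IV VG VH} (hf : IsIntegralSolution f)
    (hcost : intCost n H EH EG M f ≤ K * (n : ℝ) ^ 2 * Real.log n ^ ((2 : ℝ) / 3)) :
    ∃ (fbar : VG → VG × VH) (B : Finset VG),
      (#B : ℝ) ≤ (4 / h + 2 / ε) * K * n ∧
      (∀ g ∉ B, (G.dist g (fbar g).1 : ℝ) ≤ ε * Real.log n) ∧
      ∑ e ∈ EG with e.1 ∉ B ∧ e.2 ∉ B, termDist n H EG M (fbar e.1) (fbar e.2) ≤
        2 * K * n * Real.log n ^ ((4 : ℝ) / 3) := by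
  classical
  have hL0 : 0 < Real.log n := by linarith
  have hn0 : (0 : ℝ) < n := by exact_mod_cast hn
  have : Nonempty VH := Fintype.card_pos_iff.mp (by omega)
  choose F hF using fun x => hf.1 (Sum.inl x)
  obtain ⟨r, hr1, hr2, hr3, hr4, hr0⟩ : ∃ r : ℝ, Real.log n ^ ((1 : ℝ) / 3) = r ∧
      Real.log n ^ ((2 : ℝ) / 3) = r ^ 2 ∧ Real.log n = r ^ 3 ∧
      Real.log n ^ ((4 : ℝ) / 3) = r ^ 4 ∧ 0 < r := by
    refine ⟨_, rfl, ?_, ?_, ?_, by positivity⟩ <;>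
      rw [← Real.rpow_natCast, ← Real.rpow_mul hL0.le] <;> norm_num
  have h1 := (intra_cost_le (H := H) (EH := EH) (EG := EG) (M := M) n hF).trans hcost
  have h2 := (pendant_cost_le (H := H) (EH := EH) (EG := EG) (M := M) n hf hF).trans hcost
  have h3 := (inter_cost_le (H := H) (EH := EH) (M := M) hEG n hF).trans hcost
  simp only [← mul_sum] at h1 h2 h3
  rw [hr1, hr2, inv_mul_le_iff₀ hr0] at h1
  rw [hr2, inv_mul_le_iff₀ hL0] at h2
  rw [hr2, inv_mul_le_iff₀ (by positivity)] at h3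
  choose fbar hfbar using fun g => exists_large_fiber hh.le hH hEH fun a => F (g, a)
  rw [hVH] at hfbar
  set m : VG → ℕ := fun g => #{a | F (g, a) = fbar g} with hm
  have hcut : ∑ g, h * (n - m g : ℝ) ≤ K * n ^ 2 := by
    have h4 : ∀ g, h * (n - m g : ℝ) * r ^ 3 ≤
        ∑ p ∈ EH, termDist n H EG M (F (g, p.1)) (F (g, p.2)) := by
      intro g
      calc h * (n - m g : ℝ) * r ^ 3 ≤
          2 * #{p ∈ EH | F (g, p.1) ≠ F (g, p.2)} * r ^ 3 :=
            mul_le_mul_of_nonneg_right (hfbar g) (by positivity)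
        _ = ∑ p ∈ EH with F (g, p.1) ≠ F (g, p.2), 2 * Real.log n := by
            rw [sum_const, nsmul_eq_mul, hr3]; ring
        _ ≤ ∑ p ∈ EH with F (g, p.1) ≠ F (g, p.2),
              termDist n H EG M (F (g, p.1)) (F (g, p.2)) :=
            sum_le_sum fun p hp => two_mul_log_le_instD (mem_filter.mp hp).2
        _ ≤ _ := sum_le_sum_of_subset_of_nonneg (filter_subset _ _)
            fun _ _ _ => instD_nonneg _ _
    have h5 := (sum_le_sum fun g (_ : g ∈ univ) => h4 g).trans h1
    rw [← sum_mul] at h5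
    have h6 : r * (K * n ^ 2 * r ^ 2) = K * n ^ 2 * r ^ 3 := by ring
    rw [h6] at h5
    exact le_of_mul_le_mul_right h5 (by positivity)
  have hmn : ∀ g, (m g : ℝ) ≤ n := fun g => by
    rw [← hVH]; exact_mod_cast card_le_univ _
  set B₁ : Finset VG := {g | (n : ℝ) < 4 * (n - m g)} with hB₁
  set B₂ : Finset VG := {g | g ∉ B₁ ∧ ε * Real.log n < G.dist g (fbar g).1} with hB₂
  have hB₁c : (#B₁ : ℝ) ≤ 4 / h * K * n := by
    have h4 : (#B₁ : ℝ) * (h * (n / 4)) ≤ K * n ^ 2 := by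
      calc (#B₁ : ℝ) * (h * (n / 4)) = ∑ g ∈ B₁, h * (n / 4 : ℝ) := by
            rw [sum_const, nsmul_eq_mul]
        _ ≤ ∑ g ∈ B₁, h * (n - m g : ℝ) := by
            refine sum_le_sum fun g hg => ?_
            have := (mem_filter.mp hg).2
            gcongr
            linarith
        _ ≤ ∑ g, h * (n - m g : ℝ) := sum_le_sum_of_subset_of_nonneg (subset_univ _)
            fun g _ _ => mul_nonneg hh.le (sub_nonneg.mpr (hmn g))
        _ ≤ _ := hcut
    have h5 : (4 / h * K * n) * (h * (n / 4)) = K * n ^ 2 := by field_simp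
    rw [← h5] at h4
    exact le_of_mul_le_mul_right h4 (by positivity)
  have hmbig : ∀ g ∉ B₁, (3 / 4 : ℝ) * n ≤ m g := by
    intro g hg
    simp only [hB₁, mem_filter, mem_univ, true_and, not_lt] at hg
    linarith
  have hB₂c : (#B₂ : ℝ) ≤ 2 / ε * K * n := by
    have h4 : ∀ g ∈ B₂, ε * r ^ 5 * (n / 2) ≤ ∑ a, termDist n H EG M (F (g, a)) (g, a) := by
      intro g hg
      obtain ⟨hg1, hg2⟩ := (mem_filter.mp hg).2
      calc ε * r ^ 5 * (n / 2) ≤ ε * r ^ 5 * m g := by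
            have := hmbig g hg1
            gcongr
            linarith
        _ = ∑ a with F (g, a) = fbar g, ε * Real.log n * r ^ 2 := by
            rw [sum_const, nsmul_eq_mul, hr3]; ring
        _ ≤ ∑ a with F (g, a) = fbar g, termDist n H EG M (F (g, a)) (g, a) := by
            refine sum_le_sum fun a ha => ?_
            refine le_trans ?_ (dist_mul_le_instD hEG hX hL (F (g, a)) (g, a))
            rw [(mem_filter.mp ha).2, SimpleGraph.dist_comm, hr2]
            gcongr
        _ ≤ _ := sum_le_sum_of_subset_of_nonneg (filter_subset _ _)
            fun _ _ _ => instD_nonneg _ _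
    have h5 : (#B₂ : ℝ) * (ε * r ^ 5 * (n / 2)) ≤ Real.log n * (K * n ^ 2 * r ^ 2) := by
      calc (#B₂ : ℝ) * (ε * r ^ 5 * (n / 2)) = ∑ g ∈ B₂, ε * r ^ 5 * (n / 2 : ℝ) := by
            rw [sum_const, nsmul_eq_mul]
        _ ≤ _ := sum_le_sum h4
        _ ≤ _ := sum_le_sum_of_subset_of_nonneg (subset_univ _)
            fun g _ _ => sum_nonneg fun _ _ => instD_nonneg _ _
        _ ≤ _ := h2
    have h6 : Real.log n * (K * n ^ 2 * r ^ 2) =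
        (2 / ε * K * n) * (ε * r ^ 5 * (n / 2)) := by
      rw [hr3]; field_simp
    rw [h6] at h5
    exact le_of_mul_le_mul_right h5 (by positivity)
  refine ⟨fbar, B₁ ∪ B₂, ?_, ?_, ?_⟩
  · have : (#(B₁ ∪ B₂) : ℝ) ≤ #B₁ + #B₂ := by exact_mod_cast card_union_le _ _
    linarith
  · intro g hg
    simp only [mem_union, not_or] at hg
    by_contra hc
    exact hg.2 (mem_filter.mpr ⟨mem_univ _, hg.1, not_le.mp hc⟩)
  · have h4 : ∀ e ∈ EG.filter (fun e => e.1 ∉ B₁ ∪ B₂ ∧ e.2 ∉ B₁ ∪ B₂),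
        (n / 2 : ℝ) * termDist n H EG M (fbar e.1) (fbar e.2) ≤
          ∑ a, termDist n H EG M (F (e.1, a)) (F (e.2, M e a)) := by
      intro e he
      obtain ⟨-, he1, he2⟩ := mem_filter.mp he
      have h5 := hmbig e.1 fun h => he1 (mem_union_left _ h)
      have h6 := hmbig e.2 fun h => he2 (mem_union_left _ h)
      set S₁ : Finset VH := {a | F (e.1, a) = fbar e.1} with hS₁
      set S₂ : Finset VH := {a | F (e.2, M e a) = fbar e.2} with hS₂
      have h7 : #S₂ = m e.2 := by
        refine card_bij (fun a _ => M e a) ?_ ?_ ?_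
        · intro a ha
          simpa [hS₂] using ha
        · intro a _ b _ hab
          exact (M e).injective hab
        · intro b hb
          refine ⟨(M e).symm b, ?_, by simp⟩
          simpa [hS₂] using hb
      have h8 : #S₁ = m e.1 := rfl
      have h9 := card_union_add_card_inter S₁ S₂
      have h10 : #(S₁ ∪ S₂) ≤ n := by rw [← hVH]; exact card_le_univ _
      have h11 : (n / 2 : ℝ) ≤ #(S₁ ∩ S₂) := by
        rw [← h8] at h5
        rw [← h7] at h6
        have h9' : (#(S₁ ∪ S₂) : ℝ) + #(S₁ ∩ S₂) = #S₁ + #S₂ := by exact_mod_cast h9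
        have h10' : (#(S₁ ∪ S₂) : ℝ) ≤ n := by exact_mod_cast h10
        linarith
      calc (n / 2 : ℝ) * termDist n H EG M (fbar e.1) (fbar e.2)
          ≤ #(S₁ ∩ S₂) * termDist n H EG M (fbar e.1) (fbar e.2) := by
            gcongr
            exact instD_nonneg _ _
        _ = ∑ a ∈ S₁ ∩ S₂, termDist n H EG M (fbar e.1) (fbar e.2) := by
            rw [sum_const, nsmul_eq_mul]
        _ = ∑ a ∈ S₁ ∩ S₂, termDist n H EG M (F (e.1, a)) (F (e.2, M e a)) := by
            refine sum_congr rfl fun a ha => ?_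
            obtain ⟨ha1, ha2⟩ := mem_inter.mp ha
            rw [(mem_filter.mp ha1).2, (mem_filter.mp ha2).2]
        _ ≤ _ := sum_le_sum_of_subset_of_nonneg (subset_univ _)
            fun _ _ _ => instD_nonneg _ _
    have h5 : (n / 2 : ℝ) * ∑ e ∈ EG with e.1 ∉ B₁ ∪ B₂ ∧ e.2 ∉ B₁ ∪ B₂,
        termDist n H EG M (fbar e.1) (fbar e.2) ≤ r ^ 2 * (K * n ^ 2 * r ^ 2) := by
      rw [mul_sum]
      refine (sum_le_sum h4).trans (le_trans ?_ h3)
      exact sum_le_sum_of_subset_of_nonneg (filter_subset _ _)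
        fun _ _ _ => sum_nonneg fun _ _ => instD_nonneg _ _
    have h6 : r ^ 2 * (K * n ^ 2 * r ^ 2) = (n / 2 : ℝ) * (2 * K * n * r ^ 4) := by ring
    rw [h6] at h5
    rw [hr4]
    exact le_of_mul_le_mul_left h5 (by positivity)

end Cheap

/-! ### Edges, balls and components of the base graph -/

section BaseGraph

variable {V : Type} [DecidableEq V] [Group V] {G : SimpleGraph V} {EG : Finset (V × V)}
  {SG : Finset V}

theorem card_fst_mem_le (hEG : IsOrientation G EG) (hSG : ∀ a b, G.Adj a b ↔ a⁻¹ * b ∈ SG)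
    (S : Finset V) : #{e ∈ EG | e.1 ∈ S} ≤ #S * #SG := by
  calc #{e ∈ EG | e.1 ∈ S} ≤ #((S ×ˢ SG).image fun p => (p.1, p.1 * p.2)) := by
        refine card_le_card fun e he => ?_
        obtain ⟨he1, he2⟩ := mem_filter.mp he
        exact mem_image.mpr ⟨(e.1, e.1⁻¹ * e.2),
          mem_product.mpr ⟨he2, (hSG _ _).mp (hEG.1 e he1)⟩, by simp⟩
    _ ≤ #(S ×ˢ SG) := card_image_le
    _ = _ := card_product _ _

theorem card_snd_mem_le (hEG : IsOrientation G EG) (hSG : ∀ a b, G.Adj a b ↔ a⁻¹ * b ∈ SG)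
    (S : Finset V) : #{e ∈ EG | e.2 ∈ S} ≤ #S * #SG := by
  calc #{e ∈ EG | e.2 ∈ S} ≤ #((S ×ˢ SG).image fun p => (p.1 * p.2, p.1)) := by
        refine card_le_card fun e he => ?_
        obtain ⟨he1, he2⟩ := mem_filter.mp he
        exact mem_image.mpr ⟨(e.2, e.2⁻¹ * e.1),
          mem_product.mpr ⟨he2, (hSG _ _).mp (hEG.1 e he1).symm⟩, by simp⟩
    _ ≤ #(S ×ˢ SG) := card_image_le
    _ = _ := card_product _ _

theorem card_mul_le_two_mul_card [Fintype V] (hEG : IsOrientation G EG)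
    (hSG : ∀ a b, G.Adj a b ↔ a⁻¹ * b ∈ SG) : Fintype.card V * #SG ≤ 2 * #EG := by
  have h1 := card_cut_le_two_mul hEG (id : V → V)
  have h2 : Fintype.card V * #SG ≤ {p : V × V | G.Adj p.1 p.2 ∧ id p.1 ≠ id p.2}.ncard := by
    rw [← card_univ, ← card_product, ← card_image_of_injective (univ ×ˢ SG)
      (f := fun p : V × V => (p.1, p.1 * p.2)), ← Set.ncard_coe_finset]
    · refine Set.ncard_le_ncard ?_ (Set.toFinite _)
      intro p hp
      obtain ⟨⟨a, s⟩, hs, rfl⟩ := mem_image.mp (mem_coe.mp hp)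
      have : G.Adj a (a * s) := (hSG _ _).mpr (by simpa using hs)
      exact ⟨this, this.ne⟩
    · rintro ⟨a, s⟩ ⟨b, t⟩ hab
      simp only [Prod.mk.injEq] at hab
      obtain ⟨rfl, h⟩ := hab
      simpa using h
  have h3 := card_filter_le EG fun p : V × V => id p.1 ≠ id p.2
  omega

theorem card_ball_le [Fintype V] (hG : G.Connected) (hSG : ∀ a b, G.Adj a b ↔ a⁻¹ * b ∈ SG)
    (g : V) (R : ℕ) : #{x | G.dist x g ≤ R} ≤ (#SG + 1) ^ R := by
  induction R with
  | zero =>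
    rw [pow_zero, card_le_one]
    intro a ha b hb
    simp only [mem_filter, mem_univ, true_and, Nat.le_zero, hG.dist_eq_zero_iff] at ha hb
    rw [ha, hb]
  | succ R ih =>
    have hsub : ({x | G.dist x g ≤ R + 1} : Finset V) ⊆
        ({x | G.dist x g ≤ R} : Finset V).biUnion fun v => insert v (SG.image fun s => v * s) := by
      intro y hy
      have hy' : G.dist y g ≤ R + 1 := by simpa using hy
      obtain ⟨w, hw⟩ := hG.exists_walk_length_eq_dist y g
      rw [mem_biUnion]
      cases w with
      | nil => exact ⟨g, by simp, mem_insert_self _ _⟩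
      | @cons _ v _ hadj p =>
        rw [SimpleGraph.Walk.length_cons] at hw
        refine ⟨v, ?_, mem_insert_of_mem (mem_image.mpr
          ⟨v⁻¹ * y, (hSG _ _).mp hadj.symm, by simp⟩)⟩
        have := SimpleGraph.dist_le p
        simp only [mem_filter, mem_univ, true_and]
        omega
    calc _ ≤ _ := card_le_card hsub
      _ ≤ _ := card_biUnion_le_card_mul _ _ (#SG + 1) fun v _ =>
        (card_insert_le _ _).trans (by have := card_image_le (s := SG) (f := fun s => v * s); omega)
      _ ≤ (#SG + 1) ^ R * (#SG + 1) := Nat.mul_le_mul_right _ ih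
      _ = _ := (pow_succ _ _).symm

end BaseGraph

/-- After deleting few edges from an expander, a large component remains. -/
theorem exists_large_component {V : Type} [Fintype V] [DecidableEq V] [Nonempty V]
    {G : SimpleGraph V} {h : ℝ}
    (hh : 0 ≤ h) (hG : EdgeExpansionAtLeast G h) {EG : Finset (V × V)}
    (hEG : IsOrientation G EG) {E' : Finset (V × V)} :
    ∃ (g₀ : V) (V₀ : Finset V), (∀ g, g ∈ V₀ ↔ Relation.EqvGen (fun a b => (a, b) ∈ E') g₀ g) ∧
      h * (Fintype.card V - #V₀ : ℝ) ≤ 2 * #(EG \ E') := by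
  classical
  set r : V → V → Prop := fun a b => (a, b) ∈ E'
  obtain ⟨a, ha⟩ := exists_large_fiber hh hG hEG (Quot.mk r)
  obtain ⟨g₀, rfl⟩ := Quot.exists_rep a
  refine ⟨g₀, ({v | Quot.mk r v = Quot.mk r g₀} : Finset V), ?_, ha.trans ?_⟩
  · intro g
    simp only [mem_filter, mem_univ, true_and]
    exact ⟨fun h => (Quot.eqvGen_exact h).symm _ _, fun h => Quot.eqvGen_sound (h.symm _ _)⟩
  · gcongr
    intro e he
    obtain ⟨he1, he2⟩ := mem_filter.mp he
    exact mem_sdiff.mpr ⟨he1, fun h => he2 (Quot.sound h)⟩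

/-- If the edges of `E''` are almost reproduced by short walks between moved endpoints, up to a
subspace `W`, then there are at most `dim W + |V|` of them. -/
theorem card_le_finrank_add_card {V : Type} [Fintype V] [DecidableEq V] {G : SimpleGraph V}
    {EG E'' : Finset (V × V)} (hEG : IsOrientation G EG) (hE : E'' ⊆ EG) {k : ℕ}
    (hgirth : ∀ (v : V) (c : G.Walk v v), c.IsCycle → k < c.length) (π : V → V)
    (w : ∀ e : V × V, G.Walk (π e.1) (π e.2)) (q : ∀ g, G.Walk g (π g))
    (hlen : ∀ e ∈ E'', 1 + (q e.2).length + (w e).length + (q e.1).length ≤ k)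
    (φ : V → Sym2 V → ZMod 2) (W : Submodule (ZMod 2) (Sym2 V → ZMod 2))
    (hW : ∀ e ∈ E'', φ e.1 + φ e.2 + walkChain (w e) ∈ W) :
    #E'' ≤ Module.finrank (ZMod 2) W + Fintype.card V := by
  classical
  set ψ : V → Sym2 V → ZMod 2 := fun g => walkChain (q g) + φ g with hψ
  set b : E'' → Sym2 V → ZMod 2 := fun e => Pi.single s(e.1.1, e.1.2) 1 with hb
  have hmem : ∀ e, b e ∈ W ⊔ Submodule.span (ZMod 2) (Set.range ψ) := by
    rintro ⟨e, he⟩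
    have h0 := walkChain_eq_zero_of_length_lt
      ((((SimpleGraph.Walk.cons (hEG.1 e (hE he)) (q e.2)).append (w e).reverse).append
        (q e.1).reverse)) (fun v c hc => lt_of_le_of_lt
          (by simp only [SimpleGraph.Walk.length_append, SimpleGraph.Walk.length_cons,
                SimpleGraph.Walk.length_reverse]; have := hlen e he; omega) (hgirth v c hc))
    rw [walkChain_append, walkChain_append, walkChain_reverse, walkChain_reverse,
      walkChain_cons] at h0
    have h1 : b ⟨e, he⟩ = (φ e.1 + φ e.2 + walkChain (w e)) + (ψ e.1 + ψ e.2) := by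
      have h2 : b ⟨e, he⟩ + (φ e.1 + φ e.2 + walkChain (w e) + (ψ e.1 + ψ e.2)) =
          b ⟨e, he⟩ + walkChain (q e.2) + walkChain (w e) + walkChain (q e.1) +
            (φ e.1 + φ e.1) + (φ e.2 + φ e.2) := by
        simp only [hψ]
        abel
      rw [← sub_eq_zero, ZModModule.sub_eq_add, h2, ZModModule.add_self, ZModModule.add_self,
        add_zero, add_zero]
      exact h0
    rw [h1]
    refine Submodule.add_mem_sup (hW e he) (Submodule.add_mem _ ?_ ?_) <;>
      exact Submodule.subset_span ⟨_, rfl⟩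
  have hli : LinearIndependent (ZMod 2) b := by
    refine (Pi.linearIndependent_single_one (Sym2 V) (ZMod 2)).comp
      (fun e : E'' => s(e.1.1, e.1.2)) ?_
    rintro ⟨⟨a, b⟩, h1⟩ ⟨⟨c, d⟩, h2⟩ h
    rcases Sym2.eq_iff.mp h with ⟨rfl, rfl⟩ | ⟨rfl, rfl⟩
    · rfl
    · exact absurd (hE h2) ((hEG.2 _ _ (hEG.1 _ (hE h1))).mp (hE h1))
  have h1 : Submodule.span (ZMod 2) (Set.range b) ≤
      W ⊔ Submodule.span (ZMod 2) (Set.range ψ) :=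
    Submodule.span_le.mpr (by rintro _ ⟨e, rfl⟩; exact hmem e)
  have h2 := Submodule.finrank_mono h1
  rw [finrank_span_eq_card hli, Fintype.card_coe] at h2
  have h3 := Submodule.finrank_add_le_finrank_add_finrank W
    (Submodule.span (ZMod 2) (Set.range ψ))
  have h4 := finrank_range_le_card (R := ZMod 2) ψ
  rw [Set.finrank] at h4
  omega

/-! ### Cheap cloud maps contradict sparsity -/

theorem eqvGen_of_mem_support {V : Type} {Gr : SimpleGraph V} {r : V → V → Prop} {U : Finset V}
    (hr : ∀ a ∈ U, ∀ b ∈ U, Gr.Adj a b → Relation.EqvGen r a b) {x y : V} (p : Gr.Walk x y)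
    (hp : ∀ z ∈ p.support, z ∈ U) : ∀ z ∈ p.support, Relation.EqvGen r x z := by
  induction p with
  | nil =>
    intro z hz
    rw [SimpleGraph.Walk.support_nil, List.mem_singleton] at hz
    rw [hz]
    exact Relation.EqvGen.refl _
  | @cons x v y h p ih =>
    intro z hz
    rw [SimpleGraph.Walk.support_cons, List.mem_cons] at hz
    rcases hz with rfl | hz
    · exact Relation.EqvGen.refl _
    · exact (hr x (hp x (by simp)) v (hp v (by simp)) h).trans _ _ _
        (ih (fun z hz => hp z (by simp [hz])) z hz)

section Contradiction

variable [Fintype VG] [DecidableEq VG] [DecidableEq VH] [Group VG]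
  {G : SimpleGraph VG} {H : SimpleGraph VH} {EG : Finset (VG × VG)}
  {M : VG × VG → VH ≃ VH} {SG : Finset VG}

theorem card_candidates_le [Fintype VH] (hEG : IsOrientation G EG) (hSG : ∀ a b, G.Adj a b ↔ a⁻¹ * b ∈ SG)
    {U : Finset (VG × VH)} {B : ℕ} (hB : ∀ g, #{y ∈ U | y.1 = g} ≤ B) :
    #(candidates EG U) ≤ #U * (#SG * B) := by
  have hsub : candidates EG U ⊆ U.biUnion fun x => SG.biUnion fun s =>
      {y ∈ U | y.1 = x.1 * s}.image fun y => ((x.1, y.1), (x.2, y.2)) := by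
    intro c hc
    simp only [candidates, mem_filter, mem_univ, true_and] at hc
    obtain ⟨h1, h2, h3⟩ := hc
    simp only [mem_biUnion, mem_image, mem_filter]
    exact ⟨conFst c, h2, c.1.1⁻¹ * c.1.2, (hSG _ _).mp (hEG.1 _ h1), conSnd c,
      ⟨h3, by simp [conFst, conSnd]⟩, rfl⟩
  refine (card_le_card hsub).trans (card_biUnion_le_card_mul _ _ _ fun x _ =>
    card_biUnion_le_card_mul _ _ _ fun s _ => card_image_le.trans (hB _))

variable {n : ℕ} {γ ε : ℝ}

/-- The projection of the walks realizing a cloud map hits every cloud rarely. -/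
theorem card_support_fiber_le (hG : G.Connected) (hEG : IsOrientation G EG)
    (hSG : ∀ a b, G.Adj a b ↔ a⁻¹ * b ∈ SG) (hL : 1 ≤ Real.log n)
    (P : ∀ u v, (ExtGraph H EG M).Walk u v) (fbar : VG → VG × VH) {E' : Finset (VG × VG)}
    (hE : E' ⊆ EG) (hdist : ∀ e ∈ E', (G.dist e.1 (fbar e.1).1 : ℝ) ≤ ε * Real.log n)
    (hcost : ∀ e ∈ E', walkCost (extLen n) (P (fbar e.1) (fbar e.2)) ≤
      ε * Real.log n ^ ((5 : ℝ) / 3)) (g : VG) :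
    #{y ∈ E'.biUnion fun e => (P (fbar e.1) (fbar e.2)).support.toFinset | y.1 = g} ≤
      (#SG + 1) ^ ⌊2 * ε * Real.log n⌋₊ * #SG * (⌊ε * Real.log n ^ ((4 : ℝ) / 3)⌋₊ + 1) := by
  have hL0 : 0 < Real.log n := by linarith
  set R := ⌊2 * ε * Real.log n⌋₊ with hR
  have hsub : {y ∈ E'.biUnion fun e => (P (fbar e.1) (fbar e.2)).support.toFinset | y.1 = g} ⊆
      (E'.filter fun e => e.1 ∈ ({x | G.dist x g ≤ R} : Finset VG)).biUnion
        fun e => (P (fbar e.1) (fbar e.2)).support.toFinset := by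
    intro y hy
    obtain ⟨hy1, rfl⟩ := mem_filter.mp hy
    obtain ⟨e, he, hye⟩ := mem_biUnion.mp hy1
    refine mem_biUnion.mpr ⟨e, mem_filter.mpr ⟨he, ?_⟩, hye⟩
    obtain ⟨w, hw1, hw2, -⟩ := exists_projection hEG n (P (fbar e.1) (fbar e.2))
    have hyw := hw2 y (List.mem_toFinset.mp hye)
    have h1 : G.dist (fbar e.1).1 y.1 ≤ w.length :=
      (SimpleGraph.dist_le (w.takeUntil _ hyw)).trans (w.length_takeUntil_le_length hyw)
    have h2 : (w.length : ℝ) ≤ ε * Real.log n := by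
      have h3 := hw1.trans (hcost e he)
      have h4 : ε * Real.log n ^ ((5 : ℝ) / 3) =
          ε * Real.log n * Real.log n ^ ((2 : ℝ) / 3) := by
        rw [mul_assoc, ← Real.rpow_one_add' hL0.le (by norm_num)]
        norm_num
      rw [h4] at h3
      exact le_of_mul_le_mul_right h3 (by positivity)
    have h5 := hG.dist_triangle (u := e.1) (v := (fbar e.1).1) (w := y.1)
    simp only [mem_filter, mem_univ, true_and]
    refine Nat.le_floor ?_
    have h6 : (G.dist e.1 y.1 : ℝ) ≤ G.dist e.1 (fbar e.1).1 + w.length := by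
      exact_mod_cast h5.trans (Nat.add_le_add_left h1 _)
    linarith [hdist e he]
  refine (card_le_card hsub).trans ((card_biUnion_le_card_mul _ _
    (⌊ε * Real.log n ^ ((4 : ℝ) / 3)⌋₊ + 1) fun e he => ?_).trans (Nat.mul_le_mul_right _ ?_))
  · refine (List.toFinset_card_le _).trans ?_
    rw [SimpleGraph.Walk.length_support]
    refine Nat.succ_le_succ (Nat.le_floor ?_)
    have h3 := (length_mul_le_walkCost hL (P (fbar e.1) (fbar e.2))).trans
      (hcost e (mem_filter.mp he).1)
    have h4 : ε * Real.log n ^ ((5 : ℝ) / 3) =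
        ε * Real.log n ^ ((4 : ℝ) / 3) * Real.log n ^ ((1 : ℝ) / 3) := by
      rw [mul_assoc, ← Real.rpow_add hL0]
      norm_num
    rw [h4] at h3
    exact le_of_mul_le_mul_right h3 (by positivity)
  · calc _ ≤ #{e ∈ EG | e.1 ∈ ({x | G.dist x g ≤ R} : Finset VG)} :=
          card_le_card (filter_subset_filter _ hE)
      _ ≤ _ := card_fst_mem_le hEG hSG _
      _ ≤ _ := Nat.mul_le_mul_right _ (card_ball_le hG hSG g R)

/-- If the matchings reveal few coincidences around small connected sets then a cloud map of
small stretch is defined on few connected edges. -/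
theorem card_edges_lt_of_sparse [Fintype VH] (hG : G.Connected) (hH : H.Connected)
    (hEG : IsOrientation G EG) (hSG : ∀ a b, G.Adj a b ↔ a⁻¹ * b ∈ SG)
    (hL : 1 ≤ Real.log n) (hgirth : GirthAtLeast G (γ * Real.log n))
    (hγ : 1 + 3 * ε * Real.log n < γ * Real.log n) {Λ β : ℕ}
    (hsparse : ∀ (U : Finset (VG × VH)) (F : Finset ((VG × VG) × VH × VH)) (x₀ : VG × VH),
      x₀ ∈ U → (∀ c ∈ F, c.1 ∈ EG) → Extends M F →
      (∀ y ∈ U, Relation.EqvGen (InnerRel H U F) x₀ y) → 2 * #U ≤ Λ →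
      #(candidates EG U) ≤ Λ * (#SG * ((#SG + 1) ^ ⌊2 * ε * Real.log n⌋₊ * #SG *
        (⌊ε * Real.log n ^ ((4 : ℝ) / 3)⌋₊ + 1))) →
      #{c ∈ candidates EG U | M c.1 c.2.1 = c.2.2 ∧ c ∉ F} < β)
    (fbar : VG → VG × VH) {E' : Finset (VG × VG)} (hE : E' ⊆ EG) (hne : E'.Nonempty) {g₀ : VG}
    (hconn : ∀ e ∈ E', Relation.EqvGen (fun a b => (a, b) ∈ E') g₀ e.1)
    (hdist : ∀ e ∈ E', (G.dist e.1 (fbar e.1).1 : ℝ) ≤ ε * Real.log n ∧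
      (G.dist e.2 (fbar e.2).1 : ℝ) ≤ ε * Real.log n)
    (hcost : ∀ e ∈ E', termDist n H EG M (fbar e.1) (fbar e.2) ≤
      ε * Real.log n ^ ((5 : ℝ) / 3))
    (hΛ : 2 * (#E' + (∑ e ∈ E', termDist n H EG M (fbar e.1) (fbar e.2)) /
      Real.log n ^ ((1 : ℝ) / 3)) ≤ Λ) :
    #E' < β + Fintype.card VG := by
  classical
  have hL0 : 0 < Real.log n := by linarith
  have hX : (ExtGraph H EG M).Preconnected := extGraph_preconnected hEG hG hH
  choose P hP using exists_walk_le_instD hX hL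
  set U : Finset (VG × VH) :=
    E'.biUnion fun e => (P (fbar e.1) (fbar e.2)).support.toFinset with hU
  have hPU : ∀ e ∈ E', ∀ z ∈ (P (fbar e.1) (fbar e.2)).support, z ∈ U := fun e he z hz =>
    mem_biUnion.mpr ⟨e, he, List.mem_toFinset.mpr hz⟩
  have hPcost : ∀ e ∈ E', walkCost (extLen n) (P (fbar e.1) (fbar e.2)) ≤
      ε * Real.log n ^ ((5 : ℝ) / 3) := fun e he => (hP _ _).trans (hcost e he)
  set r := Real.log n ^ ((1 : ℝ) / 3) with hr
  have hr0 : 0 < r := by positivity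
  have hUcard : 2 * #U ≤ Λ := by
    have h1 : (#U : ℝ) ≤ #E' + (∑ e ∈ E', termDist n H EG M (fbar e.1) (fbar e.2)) / r := by
      calc (#U : ℝ) ≤ ∑ e ∈ E', (#(P (fbar e.1) (fbar e.2)).support.toFinset : ℝ) := by
            exact_mod_cast card_biUnion_le
        _ ≤ ∑ e ∈ E', (1 + termDist n H EG M (fbar e.1) (fbar e.2) / r) := by
            refine sum_le_sum fun e he => ?_
            have h2 := List.toFinset_card_le (P (fbar e.1) (fbar e.2)).support
            rw [SimpleGraph.Walk.length_support] at h2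
            have h3 : ((P (fbar e.1) (fbar e.2)).length : ℝ) ≤
                termDist n H EG M (fbar e.1) (fbar e.2) / r := by
              rw [le_div_iff₀ hr0]
              exact (length_mul_le_walkCost hL _).trans (hP _ _)
            have h4 : (#(P (fbar e.1) (fbar e.2)).support.toFinset : ℝ) ≤
                (P (fbar e.1) (fbar e.2)).length + 1 := by exact_mod_cast h2
            linarith
        _ = _ := by rw [sum_add_distrib, sum_const, nsmul_eq_mul, mul_one, sum_div]
    have h2 : (2 * #U : ℝ) ≤ Λ := by linarith
    exact_mod_cast h2
  have hcand : #(candidates EG U) ≤ Λ * (#SG * ((#SG + 1) ^ ⌊2 * ε * Real.log n⌋₊ * #SG *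
      (⌊ε * Real.log n ^ ((4 : ℝ) / 3)⌋₊ + 1))) :=
    (card_candidates_le hEG hSG fun g => card_support_fiber_le hG hEG hSG hL P fbar hE
      (fun e he => (hdist e he).1) hPcost g).trans
      (Nat.mul_le_mul_right _ (show #U ≤ Λ by omega))
  set Z : Finset ((VG × VG) × VH × VH) := {c ∈ candidates EG U | M c.1 c.2.1 = c.2.2} with hZ
  have hZmem : ∀ c ∈ Z, c.1 ∈ EG ∧ conFst c ∈ U ∧ conSnd c ∈ U ∧ M c.1 c.2.1 = c.2.2 := by
    intro c hc
    simp only [hZ, candidates, mem_filter, mem_univ, true_and] at hc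
    exact ⟨hc.1.1, hc.1.2.1, hc.1.2.2, hc.2⟩
  obtain ⟨F, hFZ, φ, W, hWrank, hφR, hφl, hφconn⟩ := exists_forest_potential
    (fun x y : VG × VH => x ∈ U ∧ y ∈ U ∧ x.1 = y.1 ∧ H.Adj x.2 y.2) conFst conSnd
    (fun c => (Pi.single s(c.1.1, c.1.2) 1 : Sym2 VG → ZMod 2)) Z
  have hinner : ∀ x y : VG × VH,
      ((x ∈ U ∧ y ∈ U ∧ x.1 = y.1 ∧ H.Adj x.2 y.2) ∨ ∃ c ∈ F, x = conFst c ∧ y = conSnd c) →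
      InnerRel H U F x y := by
    rintro x y (⟨h1, h2, h3, h4⟩ | ⟨c, hc, rfl, rfl⟩)
    · exact ⟨h1, h2, Or.inl ⟨h3, h4⟩⟩
    · obtain ⟨-, h2, h3, -⟩ := hZmem c (hFZ hc)
      exact ⟨h2, h3, Or.inr ⟨c, hc, rfl, rfl⟩⟩
  have hext : ∀ x ∈ U, ∀ y ∈ U, ExtRel H EG M x y →
      Relation.EqvGen (InnerRel H U F) x y ∧ φ x + φ y + projLabel x y ∈ W := by
    rintro x hx y hy (⟨h1, h2⟩ | ⟨h1, h2⟩)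
    · refine ⟨Relation.EqvGen.rel _ _ ⟨hx, hy, Or.inl ⟨h1, h2⟩⟩, ?_⟩
      rw [projLabel, if_pos h1, hφR x y ⟨hx, hy, h1, h2⟩, ZModModule.add_self, add_zero]
      exact W.zero_mem
    · have hz : ((x.1, y.1), (x.2, y.2)) ∈ Z := by
        simp only [hZ, candidates, mem_filter, mem_univ, true_and]
        exact ⟨⟨h1, hx, hy⟩, h2.symm⟩
      refine ⟨(hφconn _ hz).mono hinner, ?_⟩
      rw [projLabel, if_neg (hEG.1 _ h1).ne]
      exact hφl _ hz
  have hadj : ∀ x ∈ U, ∀ y ∈ U, (ExtGraph H EG M).Adj x y →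
      Relation.EqvGen (InnerRel H U F) x y ∧ φ x + φ y + projLabel x y ∈ W := by
    intro x hx y hy hxy
    rw [ExtGraph, SimpleGraph.fromRel_adj] at hxy
    rcases hxy.2 with h | h
    · exact hext x hx y hy h
    · obtain ⟨h1, h2⟩ := hext y hy x hx h
      refine ⟨h1.symm _ _, ?_⟩
      rw [add_comm (φ x)]
      have : projLabel x y = projLabel y x := by simp [projLabel, eq_comm, Sym2.eq_swap]
      rwa [this]
  have hwalk : ∀ e ∈ E', ∀ z ∈ (P (fbar e.1) (fbar e.2)).support,
      Relation.EqvGen (InnerRel H U F) (fbar e.1) z := fun e he =>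
    eqvGen_of_mem_support (fun a ha b hb hab => (hadj a ha b hb hab).1) _ (hPU e he)
  have hlift : ∀ a b, Relation.EqvGen (fun a b => (a, b) ∈ E') a b →
      Relation.EqvGen (InnerRel H U F) (fbar a) (fbar b) := by
    intro a b hab
    induction hab with
    | rel a b h => exact hwalk (a, b) h _ (SimpleGraph.Walk.end_mem_support _)
    | refl a => exact Relation.EqvGen.refl _
    | symm a b _ ih => exact ih.symm _ _
    | trans a b c _ _ ih1 ih2 => exact ih1.trans _ _ _ ih2
  obtain ⟨e₀, he₀⟩ := hne
  have hfew := hsparse U F (fbar e₀.1) (hPU e₀ he₀ _ (SimpleGraph.Walk.start_mem_support _))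
    (fun c hc => (hZmem c (hFZ hc)).1) (fun c hc => (hZmem c (hFZ hc)).2.2.2)
    (by
      intro y hy
      obtain ⟨e, he, hye⟩ := mem_biUnion.mp hy
      have h1 := hlift _ _ (((hconn e₀ he₀).symm _ _).trans _ _ _ (hconn e he))
      exact h1.trans _ _ _ (hwalk e he y (List.mem_toFinset.mp hye))) hUcard hcand
  have hZF : Z \ F = {c ∈ candidates EG U | M c.1 c.2.1 = c.2.2 ∧ c ∉ F} := by
    ext c
    simp only [hZ, mem_sdiff, mem_filter, and_assoc]
  rw [← hZF] at hfew
  choose w hw1 hw2 hw3 using fun e : VG × VG =>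
    exists_projection hEG n (P (fbar e.1) (fbar e.2))
  choose q hq using fun g => hG.exists_walk_length_eq_dist g (fbar g).1
  have hrank := card_le_finrank_add_card hEG hE (k := ⌊1 + 3 * ε * Real.log n⌋₊)
    (fun v c hc => by
      have h1 := hgirth v c hc
      have h2 := lt_of_lt_of_le hγ h1
      by_cases h3 : 0 ≤ 1 + 3 * ε * Real.log n
      · exact_mod_cast lt_of_le_of_lt (Nat.floor_le h3) h2
      · rw [Nat.floor_of_nonpos (not_le.mp h3).le]
        have := hc.three_le_length
        omega)
    (fun g => (fbar g).1) w q
    (fun e he => Nat.le_floor (by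
      have h1 : ((w e).length : ℝ) ≤ ε * Real.log n := by
        have h3 := (hw1 e).trans (hPcost e he)
        have h4 : ε * Real.log n ^ ((5 : ℝ) / 3) =
            ε * Real.log n * Real.log n ^ ((2 : ℝ) / 3) := by
          rw [mul_assoc, ← Real.rpow_one_add' hL0.le (by norm_num)]
          norm_num
        rw [h4] at h3
        exact le_of_mul_le_mul_right h3 (by positivity)
      rw [hq, hq]
      push_cast
      linarith [(hdist e he).1, (hdist e he).2]))
    (fun g => φ (fbar g)) W
    (fun e he => hw3 e φ W fun a ha b hb hab =>
      (hadj a (hPU e he a ha) b (hPU e he b hb) hab).2)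
  omega

end Contradiction

/-! ### Cheap solutions contradict sparsity -/

section Expensive

variable [Fintype VG] [Fintype VH] [DecidableEq VG] [DecidableEq VH] [Group VG]
  {G : SimpleGraph VG} {H : SimpleGraph VH} {EG : Finset (VG × VG)} {EH : Finset (VH × VH)}
  {M : VG × VG → VH ≃ VH} {SG : Finset VG}

theorem eqvGen_restrict {V : Type} {E : Finset (V × V)} {g₀ : V} {E' : Finset (V × V)}
    (hE' : ∀ a b, (a, b) ∈ E → Relation.EqvGen (fun a b => (a, b) ∈ E) g₀ a → (a, b) ∈ E')
    {a b : V} (hab : Relation.EqvGen (fun a b => (a, b) ∈ E) a b)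
    (ha : Relation.EqvGen (fun a b => (a, b) ∈ E) g₀ a) :
    Relation.EqvGen (fun a b => (a, b) ∈ E') a b := by
  induction hab with
  | rel a b h => exact Relation.EqvGen.rel _ _ (hE' a b h ha)
  | refl a => exact Relation.EqvGen.refl _
  | symm a b h ih => exact (ih (ha.trans _ _ _ (h.symm _ _))).symm _ _
  | trans a b c h1 _ ih1 ih2 => exact (ih1 ha).trans _ _ _ (ih2 (ha.trans _ _ _ h1))

/-- Bijections revealing few coincidences around small connected sets make every integral
solution expensive. -/
theorem lt_intCost_of_sparse {n d : ℕ} {h γ ε K : ℝ} (hd : 3 ≤ d) (hh : 0 < h) (hε : 0 < ε)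
    (hK : 0 < K)
    (hKsmall : (1 + 2 * d / h) * (2 * d * ((4 / h + 2 / ε) * K) + 2 * K / ε) ≤ 1 / 4)
    (hVG : Fintype.card VG = n) (hVH : Fintype.card VH = n) (hn : 0 < n)
    (hG : G.Connected) (hH : H.Connected)
    (hGexp : EdgeExpansionAtLeast G h) (hHexp : EdgeExpansionAtLeast H h)
    (hEG : IsOrientation G EG) (hEH : IsOrientation H EH)
    (hSG : ∀ a b, G.Adj a b ↔ a⁻¹ * b ∈ SG) (hSGd : #SG = d)
    (hL : 1 ≤ Real.log n) (hgirth : GirthAtLeast G (γ * Real.log n))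
    (hγ : 1 + 3 * ε * Real.log n < γ * Real.log n) {Λ : ℕ}
    (hΛ : 2 * (d * n + 2 * K * n * Real.log n) ≤ Λ)
    (hsparse : ∀ (U : Finset (VG × VH)) (F : Finset ((VG × VG) × VH × VH)) (x₀ : VG × VH),
      x₀ ∈ U → (∀ c ∈ F, c.1 ∈ EG) → Extends M F →
      (∀ y ∈ U, Relation.EqvGen (InnerRel H U F) x₀ y) → 2 * #U ≤ Λ →
      #(candidates EG U) ≤ Λ * (#SG * ((#SG + 1) ^ ⌊2 * ε * Real.log n⌋₊ * #SG *
        (⌊ε * Real.log n ^ ((4 : ℝ) / 3)⌋₊ + 1))) →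
      #{c ∈ candidates EG U | M c.1 c.2.1 = c.2.2 ∧ c ∉ F} < n / 4)
    {f : IV VG VH → IV VG VH} (hf : IsIntegralSolution f) :
    K * (n : ℝ) ^ 2 * Real.log n ^ ((2 : ℝ) / 3) < intCost n H EH EG M f := by
  classical
  by_contra! hcost
  have hL0 : 0 < Real.log n := by linarith
  have hn0 : (0 : ℝ) < n := by exact_mod_cast hn
  have hd3 : (3 : ℝ) ≤ d := by exact_mod_cast hd
  have : Nonempty VG := Fintype.card_pos_iff.mp (by omega)
  obtain ⟨fbar, B, hB, hdist, hstretch⟩ := exists_cloud_map (G := G) hh hε hVH hn hL hEG hEH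
    (extGraph_preconnected hEG hG hH) hHexp hf hcost
  set T : VG × VG → ℝ := fun e => termDist n H EG M (fbar e.1) (fbar e.2) with hT
  have hT0 : ∀ e, 0 ≤ T e := fun e => instD_nonneg _ _
  set E₀ : Finset (VG × VG) := {e ∈ EG | e.1 ∉ B ∧ e.2 ∉ B} with hE₀
  set E₁ : Finset (VG × VG) := {e ∈ E₀ | T e ≤ ε * Real.log n ^ ((5 : ℝ) / 3)} with hE₁
  set D : Finset (VG × VG) := {e ∈ E₀ | ¬ T e ≤ ε * Real.log n ^ ((5 : ℝ) / 3)} with hD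
  have hDcard : (#D : ℝ) ≤ 2 * K / ε * n := by
    have h1 : (#D : ℝ) * (ε * Real.log n ^ ((5 : ℝ) / 3)) ≤
        2 * K * n * Real.log n ^ ((5 : ℝ) / 3) := by
      calc (#D : ℝ) * (ε * Real.log n ^ ((5 : ℝ) / 3)) =
          ∑ e ∈ D, ε * Real.log n ^ ((5 : ℝ) / 3) := by rw [sum_const, nsmul_eq_mul]
        _ ≤ ∑ e ∈ D, T e := sum_le_sum fun e he => (not_le.mp (mem_filter.mp he).2).le
        _ ≤ ∑ e ∈ E₀, T e := sum_le_sum_of_subset_of_nonneg (filter_subset _ _)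
            fun e _ _ => hT0 e
        _ ≤ 2 * K * n * Real.log n ^ ((4 : ℝ) / 3) := hstretch
        _ ≤ _ := by
            gcongr 2 * K * n * ?_
            exact Real.rpow_le_rpow_of_exponent_le hL (by norm_num)
    have h2 : 2 * K * n * Real.log n ^ ((5 : ℝ) / 3) =
        (2 * K / ε * n) * (ε * Real.log n ^ ((5 : ℝ) / 3)) := by field_simp
    rw [h2] at h1
    exact le_of_mul_le_mul_right h1 (by positivity)
  have hmissing : (#(EG \ E₁) : ℝ) ≤
      (2 * d * ((4 / h + 2 / ε) * K) + 2 * K / ε) * n := by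
    have h1 : EG \ E₁ ⊆ {e ∈ EG | e.1 ∈ B} ∪ {e ∈ EG | e.2 ∈ B} ∪ D := by
      intro e he
      simp only [hE₁, hE₀, hD, mem_sdiff, mem_union, mem_filter] at he ⊢
      tauto
    have h2 := (card_le_card h1).trans ((card_union_le _ _).trans
      (Nat.add_le_add_right (card_union_le _ _) _))
    have h3 := card_fst_mem_le hEG hSG B
    have h4 := card_snd_mem_le hEG hSG B
    have h5 : #(EG \ E₁) ≤ 2 * (#B * d) + #D := by rw [hSGd] at h3 h4; omega
    have h6 : (#(EG \ E₁) : ℝ) ≤ 2 * (#B * d) + #D := by exact_mod_cast h5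
    have h7 : (#B : ℝ) * d ≤ (4 / h + 2 / ε) * K * n * d := by gcongr
    linarith
  obtain ⟨g₀, V₀, hV₀, hV₀card⟩ := exists_large_component (E' := E₁) hh.le hGexp hEG
  set E' : Finset (VG × VG) := {e ∈ E₁ | e.1 ∈ V₀} with hE'
  have hE'sub : E' ⊆ EG := (filter_subset _ _).trans ((filter_subset _ _).trans
    (filter_subset _ _))
  have hbig : (n : ℝ) + n / 4 ≤ #E' := by
    have h1 : EG ⊆ E' ∪ EG \ E₁ ∪ {e ∈ EG | e.1 ∈ V₀ᶜ} := by
      intro e he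
      simp only [hE', mem_union, mem_sdiff, mem_filter, mem_compl]
      tauto
    have h2 := (card_le_card h1).trans ((card_union_le _ _).trans
      (Nat.add_le_add_right (card_union_le _ _) _))
    have h3 := card_fst_mem_le hEG hSG V₀ᶜ
    have h4 := card_mul_le_two_mul_card hEG hSG
    rw [hSGd] at h3 h4
    rw [hVG] at h4 hV₀card
    have h5 : (#V₀ᶜ : ℝ) = n - #V₀ := by
      rw [card_compl, Nat.cast_sub (card_le_univ _), hVG]
    have h6 : (#V₀ᶜ : ℝ) ≤ 2 / h * #(EG \ E₁) := by
      rw [h5, div_mul_eq_mul_div, le_div_iff₀ hh]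
      linarith
    have h7 : (#EG : ℝ) ≤ #E' + #(EG \ E₁) + #V₀ᶜ * d := by
      exact_mod_cast h2.trans (Nat.add_le_add_left h3 _)
    have h8 : (n * d : ℝ) ≤ 2 * #EG := by exact_mod_cast h4
    have h9 : (#V₀ᶜ : ℝ) * d ≤ 2 / h * #(EG \ E₁) * d := by gcongr
    have h10 : (1 + 2 * d / h) * #(EG \ E₁) ≤ (1 / 4 : ℝ) * n := by
      calc (1 + 2 * d / h) * #(EG \ E₁) ≤
          (1 + 2 * d / h) * ((2 * d * ((4 / h + 2 / ε) * K) + 2 * K / ε) * n) := by gcongr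
        _ ≤ _ := by rw [← mul_assoc]; gcongr
    have h11 : (1 + 2 * d / h) * #(EG \ E₁) =
        (#(EG \ E₁) + 2 / h * #(EG \ E₁) * d : ℝ) := by ring
    have h12 : (3 * n : ℝ) ≤ n * d := by rw [mul_comm]; gcongr
    linarith
  have hne : E'.Nonempty := by
    rw [← card_pos]
    have : (0 : ℝ) < #E' := by linarith
    exact_mod_cast this
  have hlt := card_edges_lt_of_sparse hG hH hEG hSG hL hgirth hγ hsparse fbar hE'sub hne
    (g₀ := g₀)
    (fun e he => by
      obtain ⟨-, he2⟩ := mem_filter.mp he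
      refine eqvGen_restrict (fun a b hab hga => ?_) ((hV₀ _).mp he2) (Relation.EqvGen.refl _)
      exact mem_filter.mpr ⟨hab, (hV₀ a).mpr hga⟩)
    (fun e he => by
      have he1 := (mem_filter.mp (mem_filter.mp (mem_filter.mp he).1).1).2
      exact ⟨hdist _ he1.1, hdist _ he1.2⟩)
    (fun e he => (mem_filter.mp (mem_filter.mp he).1).2)
    (le_trans (by
      have h1 : #E' ≤ n * d := by
        refine (card_le_card hE'sub).trans ?_
        have := card_fst_mem_le hEG hSG univ
        simpa [hSGd, hVG] using this
      have h2 : (#E' : ℝ) ≤ n * d := by exact_mod_cast h1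
      have h3 : ∑ e ∈ E', T e ≤ 2 * K * n * Real.log n ^ ((4 : ℝ) / 3) :=
        le_trans (sum_le_sum_of_subset_of_nonneg ((filter_subset _ _).trans
          (filter_subset _ _)) fun e _ _ => hT0 e) hstretch
      have h4 : (∑ e ∈ E', T e) / Real.log n ^ ((1 : ℝ) / 3) ≤ 2 * K * n * Real.log n := by
        rw [div_le_iff₀ (by positivity)]
        have : Real.log n * Real.log n ^ ((1 : ℝ) / 3) = Real.log n ^ ((4 : ℝ) / 3) := by
          rw [← Real.rpow_one_add' hL0.le (by norm_num)]
          norm_num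
        rwa [mul_assoc _ (Real.log n), this]
      linarith) hΛ)
  rw [hVG] at hlt
  have h1 : (#E' : ℝ) < (n / 4 : ℕ) + n := by exact_mod_cast hlt
  have h2 : ((n / 4 : ℕ) : ℝ) ≤ n / 4 := by exact_mod_cast Nat.cast_div_le (α := ℝ)
  linarith

end Expensive

/-! ### Parameters -/

/-- A weak form of Stirling's bound for binomial coefficients. -/
theorem choose_mul_pow_le (N β : ℕ) : (N.choose β : ℝ) * β ^ β ≤ (3 * N) ^ β := by
  have h1 : (N.choose β : ℝ) ≤ N ^ β / β.factorial := Nat.choose_le_pow_div β N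
  have h2 : (β : ℝ) ^ β / β.factorial ≤ Real.exp β :=
    Real.pow_div_factorial_le_exp β (Nat.cast_nonneg _) β
  have h3 : Real.exp β ≤ 3 ^ β := by
    rw [← mul_one (β : ℝ), Real.exp_nat_mul]
    gcongr
    linarith [Real.exp_one_lt_d9]
  calc (N.choose β : ℝ) * β ^ β ≤ N ^ β / β.factorial * β ^ β := by gcongr
    _ = N ^ β * ((β : ℝ) ^ β / β.factorial) := by ring
    _ ≤ N ^ β * 3 ^ β := by gcongr; exact h2.trans h3
    _ = _ := by rw [mul_pow, mul_comm]

set_option maxHeartbeats 1000000 in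
/-- For large `n` the union bound succeeds. -/
theorem eventually_union_bound (d : ℕ) {ε K : ℝ} (hε : 0 < ε) (hK : 0 < K)
    (hεd : 8 * ε * Real.log (d + 1) ≤ 1) (hKd : 128 * K * Real.log (1 + 4 * d) ≤ 1) :
    ∀ᶠ n : ℕ in Filter.atTop, ∃ Λ : ℕ, 2 * (d * n + 2 * K * n * Real.log n) ≤ Λ ∧
      (n : ℝ) ^ 2 * (1 + 4 * d) ^ Λ *
        ((Λ * (d * ((d + 1) ^ ⌊2 * ε * Real.log n⌋₊ * d *
          (⌊ε * Real.log n ^ ((4 : ℝ) / 3)⌋₊ + 1)))).choose (n / 4) : ℝ) *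
        (3 / n) ^ (n / 4) < 1 := by
  have hlog : Filter.Tendsto (fun n : ℕ => Real.log n) Filter.atTop Filter.atTop :=
    Real.tendsto_log_atTop.comp tendsto_natCast_atTop_atTop
  set a := Real.log (1 + 4 * d) with ha
  have ha0 : 0 ≤ a := Real.log_nonneg (by have : (0 : ℝ) ≤ d := Nat.cast_nonneg _; linarith)
  set A : ℝ := 72 * (2 * d + 1 + 4 * K) * d ^ 2 * (1 + ε) with hA
  have hA0 : 0 ≤ A := by positivity
  have hlit : ∀ᶠ n : ℕ in Filter.atTop,
      A * Real.log n ^ (3 : ℝ) ≤ (n : ℝ) ^ ((1 : ℝ) / 4) := by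
    have h1 := (isLittleO_log_rpow_rpow_atTop (3 : ℝ) (show (0 : ℝ) < 1 / 4 by norm_num)).bound
      (show (0 : ℝ) < 1 / (A + 1) by positivity)
    have h2 := tendsto_natCast_atTop_atTop (R := ℝ) |>.eventually h1
    filter_upwards [h2, Filter.eventually_ge_atTop 1] with n hn hn1
    have hn0 := Real.log_natCast_nonneg n
    rw [Real.norm_of_nonneg (by positivity), Real.norm_of_nonneg (by positivity),
      div_mul_eq_mul_div, one_mul, le_div_iff₀ (by positivity)] at hn
    have : 0 ≤ Real.log n ^ (3 : ℝ) := by positivity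
    linarith
  filter_upwards [hlit, hlog.eventually_ge_atTop 1,
    hlog.eventually_ge_atTop (128 * a * (2 * d + 1)),
    Filter.eventually_ge_atTop 256] with n h1 hL h2 hn
  set L := Real.log n with hLdef
  have hL0 : 0 < L := by linarith
  have hn1 : (256 : ℝ) ≤ n := by exact_mod_cast hn
  have hn0 : (0 : ℝ) < n := by linarith
  set β := n / 4 with hβ
  have hβ8 : (n : ℝ) / 8 ≤ β := by
    have : n ≤ 8 * β := by omega
    have : (n : ℝ) ≤ 8 * β := by exact_mod_cast this
    linarith
  have hβ0 : (0 : ℝ) < β := by linarith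
  set Λ := ⌈2 * (d * n + 2 * K * n * L)⌉₊ with hΛ
  have hΛle : (Λ : ℝ) ≤ 2 * (d * n + 2 * K * n * L) + 1 :=
    (Nat.ceil_lt_add_one (by positivity)).le
  refine ⟨Λ, Nat.le_ceil _, ?_⟩
  set R := ⌊2 * ε * L⌋₊ with hR
  set S := ⌊ε * L ^ ((4 : ℝ) / 3)⌋₊ with hS
  set N := Λ * (d * ((d + 1) ^ R * d * (S + 1))) with hN
  have hexpn : ∀ t : ℝ, (n : ℝ) ^ t = Real.exp (L * t) := fun t => Real.rpow_def_of_pos hn0 t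
  have hball : ((d : ℝ) + 1) ^ R ≤ (n : ℝ) ^ ((1 : ℝ) / 4) := by
    have hd1 : (0 : ℝ) < d + 1 := by positivity
    have hd2 : 0 ≤ Real.log (d + 1) :=
      Real.log_nonneg (by have : (0 : ℝ) ≤ d := Nat.cast_nonneg _; linarith)
    rw [← Real.rpow_natCast, Real.rpow_def_of_pos hd1, hexpn]
    refine Real.exp_le_exp.mpr ?_
    have h3 : (R : ℝ) ≤ 2 * ε * L := Nat.floor_le (by positivity)
    calc Real.log (d + 1) * R ≤ Real.log (d + 1) * (2 * ε * L) := by gcongr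
      _ = (8 * ε * Real.log (d + 1)) * (L * (1 / 4)) := by ring
      _ ≤ 1 * (L * (1 / 4)) := by gcongr
      _ = _ := one_mul _
  have hSle : (S + 1 : ℝ) ≤ (1 + ε) * L ^ (2 : ℝ) := by
    have h3 : (S : ℝ) ≤ ε * L ^ ((4 : ℝ) / 3) := Nat.floor_le (by positivity)
    have h4 : L ^ ((4 : ℝ) / 3) ≤ L ^ (2 : ℝ) :=
      Real.rpow_le_rpow_of_exponent_le hL (by norm_num)
    have h5 : 1 ≤ L ^ (2 : ℝ) := Real.one_le_rpow hL (by norm_num)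
    have h6 := mul_le_mul_of_nonneg_left h4 hε.le
    linarith
  have hΛle' : (Λ : ℝ) ≤ (2 * d + 1 + 4 * K) * n * L := by
    have h3 : (d * n : ℝ) ≤ d * n * L := le_mul_of_one_le_right (by positivity) hL
    have h4 : (1 : ℝ) ≤ n * L := one_le_mul_of_one_le_of_one_le (by linarith) hL
    linarith
  have hNle : 72 * (N : ℝ) ≤ n ^ 2 * (n : ℝ) ^ (-(1 / 2) : ℝ) := by
    have hL3 : L * L ^ (2 : ℝ) = L ^ (3 : ℝ) := by
      rw [← Real.rpow_one_add' hL0.le (by norm_num)]; norm_num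
    calc 72 * (N : ℝ) = 72 * (Λ * (d * (((d : ℝ) + 1) ^ R * d * (S + 1)))) := by
          rw [hN]; push_cast; ring
      _ ≤ 72 * ((2 * d + 1 + 4 * K) * n * L *
            (d * ((n : ℝ) ^ ((1 : ℝ) / 4) * d * ((1 + ε) * L ^ (2 : ℝ))))) := by gcongr
      _ = n * (n : ℝ) ^ ((1 : ℝ) / 4) * (A * (L * L ^ (2 : ℝ))) := by rw [hA]; ring
      _ ≤ n * (n : ℝ) ^ ((1 : ℝ) / 4) * (n : ℝ) ^ ((1 : ℝ) / 4) := by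
          rw [hL3]; gcongr
      _ = n ^ 2 * (n : ℝ) ^ (-(1 / 2) : ℝ) := by
          rw [mul_assoc, ← Real.rpow_add hn0, sq, mul_assoc]
          congr 1
          rw [← Real.rpow_one_add' hn0.le (by norm_num)]
          norm_num
  have hchoose : (N.choose β : ℝ) * (3 / n) ^ β ≤ ((n : ℝ) ^ (-(1 / 2) : ℝ)) ^ β := by
    have h3 := choose_mul_pow_le N β
    have h4 : (N.choose β : ℝ) ≤ (3 * N / β) ^ β := by
      rw [div_pow, le_div_iff₀ (by positivity)]
      exact h3
    calc (N.choose β : ℝ) * (3 / n) ^ β ≤ (3 * N / β) ^ β * (3 / n) ^ β := by gcongr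
      _ = (9 * N / (β * n)) ^ β := by
          rw [← mul_pow, div_mul_div_comm]; ring
      _ ≤ _ := by
          gcongr
          rw [div_le_iff₀ (by positivity)]
          have h5 : (n : ℝ) ^ (-(1 / 2) : ℝ) * (n / 8 * n) ≤
              (n : ℝ) ^ (-(1 / 2) : ℝ) * (β * n) := by gcongr
          linarith
  have hpowβ : ((n : ℝ) ^ (-(1 / 2) : ℝ)) ^ β ≤ Real.exp (-(n * L / 16)) := by
    rw [hexpn, ← Real.exp_nat_mul]
    refine Real.exp_le_exp.mpr ?_
    have h3 := mul_le_mul_of_nonneg_right hβ8 hL0.le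
    linarith
  have hfirst : (n : ℝ) ^ 2 * (1 + 4 * d) ^ Λ ≤
      Real.exp (2 * L + a * (2 * (d * n + 2 * K * n * L) + 1)) := by
    rw [Real.exp_add]
    gcongr
    · rw [mul_comm, Real.exp_mul, hLdef, Real.exp_log hn0]
      norm_num
    · rw [← Real.rpow_natCast, Real.rpow_def_of_pos (by positivity)]
      exact Real.exp_le_exp.mpr (mul_le_mul_of_nonneg_left hΛle ha0)
  calc (n : ℝ) ^ 2 * (1 + 4 * d) ^ Λ * (N.choose β : ℝ) * (3 / n) ^ β
      = (n : ℝ) ^ 2 * (1 + 4 * d) ^ Λ * ((N.choose β : ℝ) * (3 / n) ^ β) := by ring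
    _ ≤ Real.exp (2 * L + a * (2 * (d * n + 2 * K * n * L) + 1)) *
          Real.exp (-(n * L / 16)) := by
        gcongr
        exact hchoose.trans hpowβ
    _ < 1 := by
        rw [← Real.exp_add, Real.exp_lt_one_iff]
        have h3 : 128 * K * a * (n * L) ≤ 1 * (n * L) := by gcongr
        have h4 : 128 * a * (2 * d + 1) * n ≤ L * n := by gcongr
        have h5 : a * 1 ≤ a * n := by gcongr; linarith
        have h6 : 256 * L ≤ n * L := by gcongr
        have h7 : 0 < n * L := by positivity
        linarith

/-- Integral solutions are expensive: for `d ≥ 3` and `h, γ > 0` there are `c' > 0` and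
`N` (depending only on `d, h, γ`) such that for every `n ≥ N`, every pair `(G, H)` of
connected `d`-regular Cayley graphs on `n` vertices with edge expansion at least `h` and
girth at least `γ·log n`, and every orientation of their edges, there exists a family `M`
of bijections such that every integral solution of `𝓘(X(G,H,M))` has cost at least
`c'·n²·(log n)^{2/3}`. -/
theorem integral_solutions_expensive (d : ℕ) (hd : 3 ≤ d) (h γ : ℝ) (hh : 0 < h)
    (hγ : 0 < γ) :
    ∃ c' : ℝ, 0 < c' ∧ ∃ N : ℕ, ∀ n : ℕ, N ≤ n →
      ∀ (VG VH : Type) [Fintype VG] [Fintype VH] [DecidableEq VG] [DecidableEq VH]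
        [Group VG] [Group VH] (G : SimpleGraph VG) (H : SimpleGraph VH),
        GoodPair d h γ n G H →
        ∀ EG : Finset (VG × VG), IsOrientation G EG →
        ∀ EH : Finset (VH × VH), IsOrientation H EH →
        ∃ M : VG × VG → VH ≃ VH,
          ∀ f : IV VG VH → IV VG VH, IsIntegralSolution f →
            c' * (n : ℝ) ^ 2 * Real.log n ^ ((2 : ℝ) / 3) ≤ intCost n H EH EG M f := by
  have hd0 : (0 : ℝ) < d := by exact_mod_cast (by omega : 0 < d)
  have hlogd : 0 < Real.log (d + 1) := Real.log_pos (by linarith)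
  obtain ⟨ε, hε, hεγ, hεd⟩ : ∃ ε : ℝ, 0 < ε ∧ 6 * ε ≤ γ ∧ 8 * ε * Real.log (d + 1) ≤ 1 := by
    refine ⟨min (γ / 6) (1 / (8 * Real.log (d + 1))), by positivity, ?_, ?_⟩
    · linarith [min_le_left (γ / 6) (1 / (8 * Real.log (d + 1)))]
    · have h1 := min_le_right (γ / 6) (1 / (8 * Real.log (d + 1)))
      rw [le_div_iff₀ (by positivity)] at h1
      linarith
  obtain ⟨K, hK, hK1, hK2⟩ : ∃ K : ℝ, 0 < K ∧
      (1 + 2 * d / h) * (2 * d * ((4 / h + 2 / ε) * K) + 2 * K / ε) ≤ 1 / 4 ∧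
      128 * K * Real.log (1 + 4 * d) ≤ 1 := by
    have hlog4 : 0 < Real.log (1 + 4 * d) := Real.log_pos (by linarith)
    set C : ℝ := (1 + 2 * d / h) * (2 * d * (4 / h + 2 / ε) + 2 / ε) with hC
    have hC0 : 0 < C := by positivity
    refine ⟨min (1 / (4 * C)) (1 / (128 * Real.log (1 + 4 * d))), by positivity, ?_, ?_⟩
    · have h1 := min_le_left (1 / (4 * C)) (1 / (128 * Real.log (1 + 4 * d)))
      rw [le_div_iff₀ (by positivity)] at h1
      set k := min (1 / (4 * C)) (1 / (128 * Real.log (1 + 4 * d)))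
      have h2 : (1 + 2 * d / h) * (2 * d * ((4 / h + 2 / ε) * k) + 2 * k / ε) = k * C := by
        rw [hC]; ring
      linarith
    · have h1 := min_le_right (1 / (4 * C)) (1 / (128 * Real.log (1 + 4 * d)))
      rw [le_div_iff₀ (by positivity)] at h1
      linarith
  have hlog : Filter.Tendsto (fun n : ℕ => Real.log n) Filter.atTop Filter.atTop :=
    Real.tendsto_log_atTop.comp tendsto_natCast_atTop_atTop
  obtain ⟨N, hN⟩ := Filter.eventually_atTop.mp
    ((eventually_union_bound d hε hK hεd hK2).and
      ((hlog.eventually_ge_atTop 1).and (hlog.eventually_gt_atTop (2 / γ))))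
  refine ⟨K, hK, max N 1, fun n hn VG VH _ _ _ _ _ _ G H hGH EG hEG EH hEH => ?_⟩
  obtain ⟨⟨Λ, hΛ, hbound⟩, hL, hLγ⟩ := hN n (le_of_max_le_left hn)
  obtain ⟨hVG, hVH, hG, hH, -, -, ⟨SG, hSGd, -, -, hSG⟩, ⟨SH, hSHd, -, -, hSH⟩, hGexp, hHexp,
    hgirth, -⟩ := hGH
  have hsmall : (Fintype.card (VG × VH) : ℝ) * (1 + #SH + 3 * #SG) ^ Λ *
      ((Λ * (#SG * ((#SG + 1) ^ ⌊2 * ε * Real.log n⌋₊ * #SG *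
        (⌊ε * Real.log n ^ ((4 : ℝ) / 3)⌋₊ + 1)))).choose (n / 4) : ℝ) *
      (3 / Fintype.card VH) ^ (n / 4) < 1 := by
    rw [Fintype.card_prod, hVG, hVH, hSGd, hSHd]
    have h1 : ((n * n : ℕ) : ℝ) = (n : ℝ) ^ 2 := by push_cast; ring
    have h2 : (1 + d + 3 * d : ℝ) = 1 + 4 * d := by ring
    rw [h1, h2]
    exact hbound
  obtain ⟨M, hM⟩ := exists_sparse_family hEG hSG hSH hsmall
  have hγL : 1 + 3 * ε * Real.log n < γ * Real.log n := by
    rw [div_lt_iff₀ hγ] at hLγ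
    have h1 : 6 * ε * Real.log n ≤ γ * Real.log n := by gcongr
    linarith
  exact ⟨M, fun f hf => (lt_intCost_of_sparse hd hh hε hK hK1 hVG hVH
    (le_of_max_le_right hn) hG hH hGexp hHexp hEG hEH hSG hSGd hL hgirth hγL hΛ hM hf).le⟩
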